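/- Let S be a finite set of odd prime numbers and let σ : S → {split, inert, ramified} be any prescription of splitting types. Then there exist a constant c > 0 and x₀ > 0 such that for all x ≥ x₀ the number of negative fundamental discriminants Δ with |Δ| < x such that 3 does not divide h(Δ) and such that for every p ∈ S the prime p has splitting type σ(p) in ℚ(√Δ) is at least c·x. -/

import Mathlib

open IntermediateField Filter

/-- A fundamental discriminant: `Δ ≠ 1` and either `Δ ≡ 1 (mod 4)` and `Δ` squarefree,
or `Δ ≡ 0 (mod 4)`, `Δ/4` squarefree and `Δ/4 ≡ 2, 3 (mod 4)`. -/
def IsFundamentalDiscriminant (Δ : ℤ) : Prop :=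
  Δ ≠ 1 ∧ ((Δ % 4 = 1 ∧ Squarefree Δ) ∨
    (Δ % 4 = 0 ∧ Squarefree (Δ / 4) ∧ ((Δ / 4) % 4 = 2 ∨ (Δ / 4) % 4 = 3)))

/-- The quadratic field ℚ(√Δ), realized inside ℂ. -/
noncomputable def quadField (Δ : ℤ) : IntermediateField ℚ ℂ :=
  ℚ⟮(Δ : ℂ) ^ ((1 : ℂ) / 2)⟯

/-- The class number `h(Δ)` of ℚ(√Δ): the cardinality of the ideal class group of its
ring of integers. -/
noncomputable def classNum (Δ : ℤ) : ℕ :=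
  Nat.card (ClassGroup (integralClosure ℤ (quadField Δ)))

/-- The three possible splitting types of an odd prime in a quadratic field. -/
inductive SplittingType : Type
  | split : SplittingType
  | inert : SplittingType
  | ramified : SplittingType

/-- For an odd prime `p` and a fundamental discriminant `Δ`: `p` splits in ℚ(√Δ) if the
Legendre symbol `(Δ/p)` is `1`, `p` is inert if `(Δ/p) = -1`, and `p` ramifies if `p ∣ Δ`. -/
def HasSplittingType (p : ℕ) (Δ : ℤ) : SplittingType → Prop
  | .split => if hp : p.Prime then @legendreSym p ⟨hp⟩ Δ = 1 else False
  | .inert => if hp : p.Prime then @legendreSym p ⟨hp⟩ Δ = -1 else False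
  | .ramified => (p : ℤ) ∣ Δ

/-- The discriminant of the Hessian of the binary cubic form `a x³ + 3b x²y + 3c xy² + d y³`. -/
def cubicDisc {R : Type*} [CommRing R] (a b c d : R) : R :=
  (b * c - a * d) ^ 2 - 4 * (b ^ 2 - a * c) * (c ^ 2 - b * d)

/-- The Hessian of the cubic form attached to a trivialisation `δ` of the cube of a lattice with
basis `α, β`, up to the factor `δ δ'`; primed letters are conjugates. -/
lemma hessian_of_cube_trivialization {F : Type*} [Field F] {s δ δ' α α' β β' D a b c d : F}
    {e₀ e₁ e₂ e₃ e₀' e₁' e₂' e₃' : F}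
    (hs : s ≠ 0) (hδ : δ ≠ 0) (hδ' : δ' ≠ 0)
    (h₀ : δ * e₀ = α ^ 3) (h₁ : δ * e₁ = α ^ 2 * β) (h₂ : δ * e₂ = α * β ^ 2) (h₃ : δ * e₃ = β ^ 3)
    (h₀' : δ' * e₀' = α' ^ 3) (h₁' : δ' * e₁' = α' ^ 2 * β') (h₂' : δ' * e₂' = α' * β' ^ 2)
    (h₃' : δ' * e₃' = β' ^ 3)
    (ha : e₀ - e₀' = a * s) (hb : e₁ - e₁' = b * s) (hc : e₂ - e₂' = c * s)
    (hd : e₃ - e₃' = d * s) (hD : α * β' - α' * β = D * s) :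
    δ * δ' * (b ^ 2 - a * c) = α * α' * D ^ 2 ∧
    δ * δ' * (b * c - a * d) = (α * β' + α' * β) * D ^ 2 ∧
    δ * δ' * (c ^ 2 - b * d) = β * β' * D ^ 2 := by
  have e0 : e₀ = α ^ 3 / δ := by field_simp; linear_combination h₀
  have e1 : e₁ = α ^ 2 * β / δ := by field_simp; linear_combination h₁
  have e2 : e₂ = α * β ^ 2 / δ := by field_simp; linear_combination h₂
  have e3 : e₃ = β ^ 3 / δ := by field_simp; linear_combination h₃
  have e0' : e₀' = α' ^ 3 / δ' := by field_simp; linear_combination h₀'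
  have e1' : e₁' = α' ^ 2 * β' / δ' := by field_simp; linear_combination h₁'
  have e2' : e₂' = α' * β' ^ 2 / δ' := by field_simp; linear_combination h₂'
  have e3' : e₃' = β' ^ 3 / δ' := by field_simp; linear_combination h₃'
  have ha' : a = (e₀ - e₀') / s := by field_simp; linear_combination -ha
  have hb' : b = (e₁ - e₁') / s := by field_simp; linear_combination -hb
  have hc' : c = (e₂ - e₂') / s := by field_simp; linear_combination -hc
  have hd' : d = (e₃ - e₃') / s := by field_simp; linear_combination -hd
  have hD' : D = (α * β' - α' * β) / s := by field_simp; linear_combination -hD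
  subst ha' hb' hc' hd' hD' e0 e1 e2 e3 e0' e1' e2' e3'
  refine ⟨?_, ?_, ?_⟩ <;> field_simp <;> ring

/-- Reduction of a pair of integer vectors with respect to the norm form `x² + xy + k y²`. -/
lemma exists_reduced_pair (k : ℤ) (hk : 0 < k) (P : (ℤ × ℤ) → (ℤ × ℤ) → Prop)
    (hadd : ∀ u v (n : ℤ), P u v → P u (v + n • u)) (hswap : ∀ u v, P u v → P v (-u))
    (hdet : ∀ u v, P u v → u.1 * v.2 - u.2 * v.1 ≠ 0) (hP : ∃ u v, P u v) :
    ∃ u v, P u v ∧ 0 < u.1 ^ 2 + u.1 * u.2 + k * u.2 ^ 2 ∧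
      3 * (u.1 ^ 2 + u.1 * u.2 + k * u.2 ^ 2) ^ 2 ≤ (4 * k - 1) * (u.1 * v.2 - u.2 * v.1) ^ 2 := by
  classical
  let N : ℤ × ℤ → ℤ := fun u => u.1 ^ 2 + u.1 * u.2 + k * u.2 ^ 2
  have hN : ∀ u, 0 ≤ N u := fun u => by
    simp only [N]; nlinarith [sq_nonneg (2 * u.1 + u.2), sq_nonneg u.2]
  have hex : ∃ n : ℕ, ∃ u v, P u v ∧ N u = n := by
    obtain ⟨u, v, h⟩ := hP
    exact ⟨(N u).toNat, u, v, h, by rw [Int.toNat_of_nonneg (hN u)]⟩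
  obtain ⟨u, v, huv, hu⟩ := Nat.find_spec hex
  have hmin : ∀ u' v', P u' v' → N u ≤ N u' := by
    intro u' v' h
    have := Nat.find_min' hex ⟨u', v', h, (Int.toNat_of_nonneg (hN u')).symm⟩
    have h2 := Int.toNat_of_nonneg (hN u')
    omega
  have hpos : 0 < N u := by
    rcases (hN u).lt_or_eq with h | h
    · exact h
    · exfalso
      apply hdet u v huv
      have h' : u.1 ^ 2 + u.1 * u.2 + k * u.2 ^ 2 = 0 := h.symm
      have h2 : u.2 = 0 := by
        have : (4 * k - 1) * u.2 ^ 2 = 0 := by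
          nlinarith [sq_nonneg (2 * u.1 + u.2), sq_nonneg u.2]
        rcases mul_eq_zero.mp this with h | h
        · omega
        · exact pow_eq_zero_iff (two_ne_zero) |>.mp h
      have h1 : u.1 = 0 := by
        rw [h2] at h'
        have : u.1 ^ 2 = 0 := by linarith
        exact pow_eq_zero_iff (two_ne_zero) |>.mp this
      rw [h1, h2]; ring
  set t : ℤ := 2 * u.1 * v.1 + u.1 * v.2 + u.2 * v.1 + 2 * k * u.2 * v.2 with ht
  set A := N u with hA
  obtain ⟨n, hn1, hn2⟩ : ∃ n : ℤ, t + n * (2 * A) ≤ A ∧ -A ≤ t + n * (2 * A) := by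
    refine ⟨-((t + A) / (2 * A)), ?_, ?_⟩
    · have := Int.lt_ediv_add_one_mul_self (t + A) (by positivity : 0 < 2 * A)
      linarith
    · have := Int.ediv_mul_le (t + A) (by positivity : 2 * A ≠ 0)
      linarith
  refine ⟨u, v + n • u, hadd u v n huv, hpos, ?_⟩
  have hC := hmin _ _ (hswap _ _ (hadd u v n huv))
  set w := v + n • u with hw
  have hw1 : w.1 = v.1 + n * u.1 := by simp [hw]
  have hw2 : w.2 = v.2 + n * u.2 := by simp [hw]
  have htw : 2 * u.1 * w.1 + u.1 * w.2 + u.2 * w.1 + 2 * k * u.2 * w.2 = t + n * (2 * A) := by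
    rw [hw1, hw2, ht, hA]; simp only [N]; ring
  have key : (4 * k - 1) * (u.1 * w.2 - u.2 * w.1) ^ 2 = 4 * N u * N w -
      (2 * u.1 * w.1 + u.1 * w.2 + u.2 * w.1 + 2 * k * u.2 * w.2) ^ 2 := by
    simp only [N]; ring
  rw [key, htw]
  change 3 * A ^ 2 ≤ _
  have : (t + n * (2 * A)) ^ 2 ≤ A ^ 2 := sq_le_sq' hn2 hn1
  nlinarith

open ComplexConjugate in
/-- In an imaginary quadratic order of odd squarefree discriminant `Δ`, a nonprincipal ideal with
principal cube yields a binary cubic form whose Hessian has discriminant `Δ`. -/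
lemma exists_cubicDisc_eq_of_ideal {O : Type*} [CommRing O] [IsDedekindDomain O]
    (B : Module.Basis (Fin 2) ℤ O) (φ : O →+* ℂ) (hφ : Function.Injective φ) (s : ℂ) (k : ℤ)
    (hk : 0 < k) (hs : s ^ 2 = ((1 - 4 * k : ℤ) : ℂ)) (hsconj : conj s = -s)
    (hB0 : φ (B 0) = 1) (hB1 : φ (B 1) = (1 + s) / 2) (hsq : Squarefree (1 - 4 * k))
    (I : Ideal O) (hI : ¬ Submodule.IsPrincipal I) (hI3 : Submodule.IsPrincipal (I ^ 3)) :
    ∃ a b c d : ℤ, a ≠ 0 ∧ cubicDisc a b c d = 1 - 4 * k ∧ 0 < b ^ 2 - a * c ∧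
      3 * (b ^ 2 - a * c) ^ 2 ≤ -(1 - 4 * k) := by
  have : Module.Free ℤ O := Module.Free.of_basis B
  have : Module.Finite ℤ O := Module.Finite.of_basis B
  have hs0 : s ≠ 0 := by
    rintro rfl
    have : ((1 - 4 * k : ℤ) : ℂ) = 0 := by rw [← hs]; ring
    have : (1 - 4 * k : ℤ) = 0 := by exact_mod_cast this
    omega
  have hI0 : I ≠ ⊥ := by
    rintro rfl
    exact hI ⟨0, by simp⟩
  -- coordinates
  have hx : ∀ x : O, φ x = (B.repr x 0 : ℂ) + (B.repr x 1 : ℂ) * ((1 + s) / 2) := by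
    intro x
    conv_lhs => rw [← B.sum_repr x]
    simp [Fin.sum_univ_two, hB0, hB1]
  have hx' : ∀ x : O, conj (φ x) = (B.repr x 0 : ℂ) + (B.repr x 1 : ℂ) * ((1 - s) / 2) := by
    intro x
    rw [hx x]
    simp [hsconj, sub_eq_add_neg, map_ofNat]
  have hdiff : ∀ x : O, φ x - conj (φ x) = (B.repr x 1 : ℂ) * s := by
    intro x; rw [hx', hx]; ring
  have hs' : s ^ 2 = 1 - 4 * (k : ℂ) := by rw [hs]; push_cast; ring
  have hnorm : ∀ x : O, φ x * conj (φ x) =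
      (((B.repr x 0) ^ 2 + B.repr x 0 * B.repr x 1 + k * (B.repr x 1) ^ 2 : ℤ) : ℂ) := by
    intro x; rw [hx', hx]; push_cast
    linear_combination (-(B.repr x 1 : ℂ) ^ 2 / 4) * hs'
  -- norms of elements
  have hB1sq : B 1 * B 1 = B 1 - (k : O) := by
    apply hφ
    simp only [map_mul, map_sub, hB1, map_intCast]
    linear_combination (1 / 4) * hs'
  have hB0' : B 0 = 1 := by apply hφ; rw [hB0, map_one]
  have hrepr : ∀ (x : O) (u v : ℤ), x = (u : O) + v * B 1 → B.repr x 0 = u ∧ B.repr x 1 = v := by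
    intro x u v h
    have h' : x = u • B 0 + v • B 1 := by rw [h, hB0']; simp
    rw [h', map_add, map_zsmul, map_zsmul, B.repr_self, B.repr_self]
    constructor <;> simp
  have hxO : ∀ x : O, x = (B.repr x 0 : O) + (B.repr x 1 : O) * B 1 := by
    intro x
    conv_lhs => rw [← B.sum_repr x]
    simp [Fin.sum_univ_two, hB0']
  have hNabs : ∀ x : O, (Ideal.absNorm (Ideal.span {x}) : ℤ) =
      (B.repr x 0) ^ 2 + B.repr x 0 * B.repr x 1 + k * (B.repr x 1) ^ 2 := by
    intro x
    rw [Ideal.absNorm_span_singleton, Algebra.norm_eq_matrix_det B, Matrix.det_fin_two]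
    simp only [Algebra.leftMulMatrix_eq_repr_mul]
    obtain ⟨h1, h2⟩ := hrepr (x * B 0) _ _ (by rw [hB0', mul_one]; exact hxO x)
    obtain ⟨h3, h4⟩ := hrepr (x * B 1) (-k * B.repr x 1) (B.repr x 0 + B.repr x 1) (by
      conv_lhs => rw [hxO x]
      push_cast
      linear_combination (B.repr x 1 : O) * hB1sq)
    rw [h1, h2, h3, h4, Int.natCast_natAbs, abs_of_nonneg]
    · ring
    · nlinarith [sq_nonneg (2 * B.repr x 0 + B.repr x 1), sq_nonneg (B.repr x 1)]
  -- a basis of the ideal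
  let e : O → ℤ × ℤ := fun x => (B.repr x 0, B.repr x 1)
  let bI := Ideal.selfBasis B I hI0
  have hdetI := Ideal.natAbs_det_basis_change B I bI
  set m := Ideal.absNorm I with hm
  have hm0 : m ≠ 0 := by
    rw [hm, Ne, Ideal.absNorm_eq_zero_iff]; exact hI0
  let P : (ℤ × ℤ) → (ℤ × ℤ) → Prop := fun u v => ∃ α ∈ I, ∃ β ∈ I, e α = u ∧ e β = v ∧
    (u.1 * v.2 - u.2 * v.1) ^ 2 = (m : ℤ) ^ 2
  have hP : ∃ u v, P u v := by
    refine ⟨_, _, bI 0, (bI 0).2, bI 1, (bI 1).2, rfl, rfl, ?_⟩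
    rw [← hdetI, Int.natCast_natAbs, sq_abs, Module.Basis.det_apply, Matrix.det_fin_two]
    simp only [Module.Basis.toMatrix_apply, e, Function.comp]
    ring
  obtain ⟨u, v, ⟨α, hα, β, hβ, rfl, rfl, hdet⟩, hApos, hred⟩ := exists_reduced_pair k hk P
    (by
      rintro u v n ⟨α, hα, β, hβ, rfl, rfl, h⟩
      refine ⟨α, hα, β + n • α, I.add_mem hβ (zsmul_mem hα n), rfl, ?_, ?_⟩
      · simp only [e, map_add, map_zsmul]; rfl
      · rw [← h]; simp only [Prod.fst_add, Prod.snd_add, Prod.smul_fst, Prod.smul_snd, smul_eq_mul]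
        ring)
    (by
      rintro u v ⟨α, hα, β, hβ, rfl, rfl, h⟩
      refine ⟨β, hβ, -α, I.neg_mem hα, rfl, ?_, ?_⟩
      · simp [e]
      · rw [← h]; simp only [Prod.fst_neg, Prod.snd_neg]; ring)
    (by
      rintro u v ⟨α, hα, β, hβ, rfl, rfl, h⟩ h0
      rw [h0] at h
      have : (m : ℤ) = 0 := by
        have : (m : ℤ) ^ 2 = 0 := by rw [← h]; ring
        exact pow_eq_zero_iff two_ne_zero |>.mp this
      exact hm0 (by exact_mod_cast this)) hP
  rw [hdet] at hred
  obtain ⟨δ, hδ⟩ := hI3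
  have hδ' : I ^ 3 = Ideal.span {δ} := hδ
  have hdiv : ∀ x ∈ I, ∀ y ∈ I, ∀ z ∈ I, ∃ w, δ * w = x * y * z := by
    intro x hx y hy z hz
    have : x * y * z ∈ Ideal.span {δ} := by
      rw [← hδ', pow_succ, pow_two]
      exact Ideal.mul_mem_mul (Ideal.mul_mem_mul hx hy) hz
    obtain ⟨w, hw⟩ := Ideal.mem_span_singleton'.mp this
    exact ⟨w, by rw [mul_comm]; exact hw⟩
  have hδN : (B.repr δ 0) ^ 2 + B.repr δ 0 * B.repr δ 1 + k * (B.repr δ 1) ^ 2 = (m : ℤ) ^ 3 := by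
    rw [← hNabs, ← hδ', map_pow]; push_cast; rfl
  have hδ0 : φ δ ≠ 0 := by
    intro h
    have := hnorm δ
    rw [h, hδN] at this
    have h0 : ((m : ℤ) ^ 3 : ℤ) = 0 := by
      have : (((m : ℤ) ^ 3 : ℤ) : ℂ) = 0 := by rw [← this]; ring
      exact_mod_cast this
    exact hm0 (by exact_mod_cast (pow_eq_zero_iff three_ne_zero).mp h0)
  obtain ⟨e₀, h₀⟩ := hdiv α hα α hα α hα
  obtain ⟨e₁, h₁⟩ := hdiv α hα α hα β hβ
  obtain ⟨e₂, h₂⟩ := hdiv α hα β hβ β hβ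
  obtain ⟨e₃, h₃⟩ := hdiv β hβ β hβ β hβ
  have H₀ : φ δ * φ e₀ = φ α ^ 3 := by rw [← map_mul, h₀]; simp only [map_mul]; ring
  have H₁ : φ δ * φ e₁ = φ α ^ 2 * φ β := by rw [← map_mul, h₁]; simp only [map_mul]; ring
  have H₂ : φ δ * φ e₂ = φ α * φ β ^ 2 := by rw [← map_mul, h₂]; simp only [map_mul]; ring
  have H₃ : φ δ * φ e₃ = φ β ^ 3 := by rw [← map_mul, h₃]; simp only [map_mul]; ring
  have K₀ := congrArg conj H₀
  have K₁ := congrArg conj H₁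
  have K₂ := congrArg conj H₂
  have K₃ := congrArg conj H₃
  simp only [map_mul, map_pow] at K₀ K₁ K₂ K₃
  set a := B.repr e₀ 1 with ha
  set b := B.repr e₁ 1 with hb
  set c := B.repr e₂ 1 with hc
  set d := B.repr e₃ 1 with hd
  set D : ℤ := B.repr α 1 * B.repr β 0 - B.repr α 0 * B.repr β 1 with hD
  obtain ⟨E1, E2, E3⟩ := hessian_of_cube_trivialization hs0 hδ0
    (by simpa using hδ0) H₀ H₁ H₂ H₃ K₀ K₁ K₂ K₃ (hdiff e₀) (hdiff e₁) (hdiff e₂) (hdiff e₃)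
    (D := (D : ℂ)) (by rw [hx' α, hx α, hx' β, hx β, hD]; push_cast; ring)
  have hDm : D ^ 2 = (m : ℤ) ^ 2 := by rw [← hdet, hD]; simp only [e]; ring
  have htr : φ α * conj (φ β) + conj (φ α) * φ β = ((2 * B.repr α 0 * B.repr β 0 +
      B.repr α 0 * B.repr β 1 + B.repr α 1 * B.repr β 0 + 2 * k * B.repr α 1 * B.repr β 1 : ℤ) : ℂ)
      := by
    rw [hx' α, hx' β, hx α, hx β]; push_cast
    linear_combination (-(B.repr α 1 * B.repr β 1 : ℂ) / 2) * hs'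
  rw [hnorm, hnorm, hδN] at E1
  rw [hnorm, htr, hδN] at E2
  rw [hnorm, hnorm, hδN] at E3
  change 0 < (B.repr α 0) ^ 2 + B.repr α 0 * B.repr α 1 + k * (B.repr α 1) ^ 2 at hApos
  change 3 * ((B.repr α 0) ^ 2 + B.repr α 0 * B.repr α 1 + k * (B.repr α 1) ^ 2) ^ 2 ≤ _ at hred
  set NA := (B.repr α 0) ^ 2 + B.repr α 0 * B.repr α 1 + k * (B.repr α 1) ^ 2 with hNA
  set NB := (B.repr β 0) ^ 2 + B.repr β 0 * B.repr β 1 + k * (B.repr β 1) ^ 2 with hNB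
  have hmZ : (m : ℤ) ≠ 0 := by exact_mod_cast hm0
  have cancel : ∀ p q : ℤ, (((m : ℤ) ^ 3 : ℤ) : ℂ) * (p : ℂ) = (q : ℂ) * (D : ℂ) ^ 2 →
      (m : ℤ) * p = q := by
    intro p q h
    have h' : (m : ℤ) ^ 3 * p = q * D ^ 2 := by exact_mod_cast h
    rw [hDm] at h'
    apply mul_left_cancel₀ (pow_ne_zero 2 hmZ)
    linear_combination h'
  have F1 := cancel (b ^ 2 - a * c) _ (by push_cast at E1 ⊢; exact E1)
  have F2 := cancel (b * c - a * d) (2 * B.repr α 0 * B.repr β 0 + B.repr α 0 * B.repr β 1 +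
    B.repr α 1 * B.repr β 0 + 2 * k * B.repr α 1 * B.repr β 1) (by push_cast at E2 ⊢; exact E2)
  have F3 := cancel (c ^ 2 - b * d) _ (by push_cast at E3 ⊢; exact E3)
  have hmpos : (0 : ℤ) < m := by positivity
  have hdisc : cubicDisc a b c d = 1 - 4 * k := by
    apply mul_left_cancel₀ (pow_ne_zero 2 hmZ)
    have : (m : ℤ) ^ 2 * cubicDisc a b c d = (m * (b * c - a * d)) ^ 2 -
        4 * (m * (b ^ 2 - a * c)) * (m * (c ^ 2 - b * d)) := by unfold cubicDisc; ring
    rw [this, F1, F2, F3, ← hDm, hD, hNA, hNB]; ring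
  have hA0 : 0 < b ^ 2 - a * c := by
    rw [← F1] at hApos
    exact pos_of_mul_pos_right hApos hmpos.le
  refine ⟨a, b, c, d, ?_, hdisc, hA0, ?_⟩
  · intro ha0
    have hbu : IsUnit b := hsq b ⟨4 * b * d - 3 * c ^ 2, by
      rw [← hdisc, cubicDisc, ha0]; ring⟩
    have hb2 : b ^ 2 = 1 := Int.isUnit_iff.mp hbu |>.elim (fun h => by rw [h]; rfl)
      (fun h => by rw [h]; rfl)
    rw [ha0, hb2] at F1
    have hle : Ideal.span {α} ≤ I := (Ideal.span_singleton_le_iff_mem I).mpr hα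
    obtain ⟨J, hJ⟩ := Ideal.dvd_iff_le.mpr hle
    have hJ1 : Ideal.absNorm J = 1 := by
      have h1 : (Ideal.absNorm (Ideal.span {α}) : ℤ) = m := by rw [hNabs, ← hNA, ← F1]; ring
      rw [hJ, map_mul] at h1
      have h2 : m * Ideal.absNorm J = m := by exact_mod_cast h1
      exact Nat.eq_of_mul_eq_mul_left (Nat.pos_of_ne_zero hm0) (by rw [h2, mul_one])
    rw [Ideal.absNorm_eq_one_iff.mp hJ1, Ideal.mul_top] at hJ
    exact hI ⟨α, hJ.symm⟩
  · rw [← F1] at hred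
    have h2 : (0 : ℤ) < (m : ℤ) ^ 2 := by positivity
    have h3 : (m : ℤ) ^ 2 * (3 * (b ^ 2 - a * c) ^ 2) ≤ (m : ℤ) ^ 2 * -(1 - 4 * k) := by
      linarith
    exact le_of_mul_le_mul_left h3 h2

lemma exists_int_eq_of_isIntegral {q : ℚ} (h : IsIntegral ℤ (q : ℂ)) : ∃ n : ℤ, (n : ℚ) = q := by
  have h' : IsIntegral ℤ (algebraMap ℚ ℂ q) := by simpa using h
  rw [isIntegral_algebraMap_iff (algebraMap ℚ ℂ).injective] at h'
  obtain ⟨n, hn⟩ := IsIntegrallyClosed.isIntegral_iff.mp h'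
  exact ⟨n, by simpa using hn⟩

lemma sqrt_sq_complex (Δ : ℤ) : ((Δ : ℂ) ^ ((1 : ℂ) / 2)) ^ 2 = (Δ : ℂ) := by
  rw [one_div, Complex.cpow_ofNat_inv_pow]

open ComplexConjugate in
lemma conj_eq_neg_of_sq_neg {s : ℂ} {Δ : ℤ} (hΔ : Δ < 0) (h : s ^ 2 = (Δ : ℂ)) :
    conj s = -s := by
  have him : s.re * s.im = 0 := by
    have := congrArg Complex.im h
    simp [pow_two] at this
    linarith
  have hre : s.re * s.re - s.im * s.im = Δ := by
    have := congrArg Complex.re h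
    simpa [pow_two] using this
  have hneg : (Δ : ℝ) < 0 := by exact_mod_cast hΔ
  have h0 : s.re = 0 := by
    rcases mul_eq_zero.mp him with h | h
    · exact h
    · rw [h] at hre; nlinarith [mul_self_nonneg s.re]
  apply Complex.ext <;> simp [h0]

lemma exists_rat_coords_of_mem_adjoin {s : ℂ} {Δ : ℤ} (h : s ^ 2 = (Δ : ℂ)) {z : ℂ}
    (hz : z ∈ ℚ⟮s⟯) : ∃ p q : ℚ, z = p + q * s := by
  induction hz using IntermediateField.adjoin_induction with
  | mem x hx => exact ⟨0, 1, by simp [Set.mem_singleton_iff.mp hx]⟩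
  | algebraMap x => exact ⟨x, 0, by simp⟩
  | add x y _ _ hx hy =>
    obtain ⟨p, q, rfl⟩ := hx
    obtain ⟨p', q', rfl⟩ := hy
    exact ⟨p + p', q + q', by push_cast; ring⟩
  | inv x _ hx =>
    obtain ⟨p, q, rfl⟩ := hx
    by_cases h0 : (p : ℂ) + q * s = 0
    · exact ⟨0, 0, by rw [h0]; simp⟩
    by_cases h1 : (p : ℂ) - q * s = 0
    · refine ⟨1 / (2 * p), 0, ?_⟩
      have : (p : ℂ) + q * s = 2 * p := by linear_combination -h1
      rw [this]; push_cast; ring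
    · have h2 : (p : ℂ) ^ 2 - Δ * q ^ 2 ≠ 0 := by
        have : (p : ℂ) ^ 2 - Δ * q ^ 2 = (p + q * s) * (p - q * s) := by rw [← h]; ring
        rw [this]; exact mul_ne_zero h0 h1
      refine ⟨p / (p ^ 2 - Δ * q ^ 2), -q / (p ^ 2 - Δ * q ^ 2), ?_⟩
      apply inv_eq_of_mul_eq_one_right
      rw [← div_self h2]
      push_cast
      rw [← h]
      ring
  | mul x y _ _ hx hy =>
    obtain ⟨p, q, rfl⟩ := hx
    obtain ⟨p', q', rfl⟩ := hy
    exact ⟨p * p' + q * q' * Δ, p * q' + q * p', by push_cast; rw [← h]; ring⟩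

open ComplexConjugate in
lemma exists_int_coords_of_isIntegral {s : ℂ} {Δ : ℤ} (hneg : Δ < 0) (h4 : Δ % 4 = 1)
    (hsq : Squarefree Δ) (h : s ^ 2 = (Δ : ℂ)) {z : ℂ} (hz : z ∈ ℚ⟮s⟯) (hi : IsIntegral ℤ z) :
    ∃ m n : ℤ, z = m + n * ((1 + s) / 2) := by
  obtain ⟨p, q, rfl⟩ := exists_rat_coords_of_mem_adjoin h hz
  have hc : IsIntegral ℤ (conj ((p : ℂ) + q * s)) := hi.map (Complex.conjAe.restrictScalars ℤ)
  have hconj : conj ((p : ℂ) + q * s) = p - q * s := by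
    rw [map_add, map_mul, conj_eq_neg_of_sq_neg hneg h]
    simp [sub_eq_add_neg]
  rw [hconj] at hc
  obtain ⟨t, ht⟩ := exists_int_eq_of_isIntegral (q := 2 * p) (by
    have e : (((2 * p : ℚ)) : ℂ) = (p + q * s) + (p - q * s) := by push_cast; ring
    rw [e]
    exact hi.add hc)
  obtain ⟨N, hN⟩ := exists_int_eq_of_isIntegral (q := p ^ 2 - Δ * q ^ 2) (by
    have e : ((p ^ 2 - Δ * q ^ 2 : ℚ) : ℂ) = (p + q * s) * (p - q * s) := by
      push_cast; rw [← h]; ring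
    rw [e]
    exact hi.mul hc)
  have hq : (Δ : ℚ) * (2 * q) ^ 2 = ((t ^ 2 - 4 * N : ℤ) : ℚ) := by
    push_cast
    rw [hN, ht]; ring
  -- `2q` is an integer since `Δ` is squarefree
  obtain ⟨n, hn⟩ : ∃ n : ℤ, (n : ℚ) = 2 * q := by
    have hden : ((2 * q).den : ℤ) * (2 * q).den ∣ Δ := by
      have h1 : Δ * (2 * q).num ^ 2 = (t ^ 2 - 4 * N) * ((2 * q).den : ℤ) ^ 2 := by
        have h2 := hq
        rw [← Rat.num_div_den (2 * q)] at h2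
        have h3 : (((2 * q).den : ℤ) : ℚ) ≠ 0 := by
          exact_mod_cast (2 * q).den_ne_zero
        field_simp at h2
        have h4 : (((Δ * (2 * q).num ^ 2 : ℤ)) : ℚ) =
            (((t ^ 2 - 4 * N) * ((2 * q).den : ℤ) ^ 2 : ℤ) : ℚ) := by
          push_cast at h2 ⊢
          linear_combination h2
        exact_mod_cast h4
      have hcop : IsCoprime (((2 * q).den : ℤ) * (2 * q).den) ((2 * q).num ^ 2) := by
        have : IsCoprime ((2 * q).den : ℤ) (2 * q).num := by
          rw [Int.isCoprime_iff_gcd_eq_one, Int.gcd_comm]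
          exact (2 * q).reduced
        exact (this.mul_left this).pow_right
      exact hcop.dvd_of_dvd_mul_right ⟨t ^ 2 - 4 * N, by rw [h1]; ring⟩
    have hu := hsq _ hden
    have h1 : (2 * q).den = 1 := by
      have := Int.isUnit_iff.mp hu
      omega
    exact ⟨(2 * q).num, Rat.coe_int_num_of_den_eq_one h1⟩
  have hpar : (t ^ 2 - Δ * n ^ 2) = 4 * N := by
    rw [← hn] at hq
    have : Δ * n ^ 2 = t ^ 2 - 4 * N := by exact_mod_cast hq
    linarith
  obtain ⟨m, hm⟩ : ∃ m : ℤ, t - n = 2 * m := by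
    have h1 : (t ^ 2 - Δ * n ^ 2) % 4 = 0 := by omega
    obtain ⟨k, hk⟩ : ∃ k, Δ = 4 * k + 1 := ⟨Δ / 4, by omega⟩
    have h2 : Even ((t - n) * (t + n)) := by
      rw [even_iff_two_dvd]
      exact ⟨2 * (N + k * n ^ 2), by rw [hk] at hpar; linear_combination hpar⟩
    rcases Int.even_mul.mp h2 with ⟨r, hr⟩ | ⟨r, hr⟩
    · exact ⟨r, by omega⟩
    · exact ⟨r - n, by omega⟩
  refine ⟨m, n, ?_⟩
  have e1 : (t : ℂ) = 2 * p := by exact_mod_cast congrArg (Rat.cast : ℚ → ℂ) ht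
  have e2 : (n : ℂ) = 2 * q := by exact_mod_cast congrArg (Rat.cast : ℚ → ℂ) hn
  have e3 : (t : ℂ) - n = 2 * m := by exact_mod_cast congrArg (Int.cast : ℤ → ℂ) hm
  linear_combination -(1 / 2) * e1 - (s / 2) * e2 + (1 / 2) * e3

lemma exists_cubicDisc_eq_of_three_dvd_classNum {Δ : ℤ} (hneg : Δ < 0) (h4 : Δ % 4 = 1)
    (hsq : Squarefree Δ) (h3 : 3 ∣ classNum Δ) :
    ∃ a b c d : ℤ, a ≠ 0 ∧ cubicDisc a b c d = Δ ∧ 0 < b ^ 2 - a * c ∧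
      3 * (b ^ 2 - a * c) ^ 2 ≤ -Δ := by
  obtain ⟨k, hk⟩ : ∃ k, Δ = 1 - 4 * k := ⟨-(Δ / 4), by omega⟩
  set s : ℂ := (Δ : ℂ) ^ ((1 : ℂ) / 2)
  have hs : s ^ 2 = (Δ : ℂ) := sqrt_sq_complex Δ
  have hsconj := conj_eq_neg_of_sq_neg hneg hs
  have hs0 : s ≠ 0 := by
    intro h0
    rw [h0] at hs
    have : (Δ : ℂ) = 0 := by rw [← hs]; ring
    have : Δ = 0 := by exact_mod_cast this
    omega
  have hsint : IsIntegral ℤ s := by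
    refine IsIntegral.of_pow two_pos ?_
    rw [hs]
    exact isIntegral_algebraMap (R := ℤ) (A := ℂ) (x := Δ)
  have hfd : FiniteDimensional ℚ (quadField Δ) :=
    IntermediateField.adjoin.finiteDimensional (hsint.tower_top)
  have : NumberField (quadField Δ) := { to_charZero := inferInstance, to_finiteDimensional := hfd }
  have hded : IsDedekindDomain (integralClosure ℤ (quadField Δ)) :=
    inferInstanceAs (IsDedekindDomain (NumberField.RingOfIntegers (quadField Δ)))
  have hfin : Finite (ClassGroup (integralClosure ℤ (quadField Δ))) :=
    inferInstanceAs (Finite (ClassGroup (NumberField.RingOfIntegers (quadField Δ))))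
  let O := integralClosure ℤ (quadField Δ)
  let φ : O →+* ℂ := (algebraMap (quadField Δ) ℂ).comp (algebraMap O (quadField Δ))
  have hφ : Function.Injective φ := by
    intro x y hxy
    exact Subtype.ext (Subtype.ext hxy)
  have hsmem : s ∈ quadField Δ := IntermediateField.mem_adjoin_simple_self ℚ s
  have hωmem : (1 + s) / 2 ∈ quadField Δ :=
    div_mem (add_mem (one_mem _) hsmem) (by exact_mod_cast _root_.natCast_mem (quadField Δ) 2)
  have hωint : IsIntegral ℤ ((1 + s) / 2) := by
    refine ⟨Polynomial.X ^ 2 - Polynomial.X + Polynomial.C k, ?_, ?_⟩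
    · monicity!
    · have hs' : s ^ 2 = 1 - 4 * (k : ℂ) := by rw [hs, hk]; push_cast; ring
      rw [Polynomial.eval₂_add, Polynomial.eval₂_sub, Polynomial.eval₂_pow, Polynomial.eval₂_X,
        Polynomial.eval₂_C, eq_intCast]
      linear_combination (1 / 4) * hs'
  have hωint' : IsIntegral ℤ (⟨(1 + s) / 2, hωmem⟩ : quadField Δ) := by
    rw [← isIntegral_algebraMap_iff (algebraMap (quadField Δ) ℂ).injective]
    exact hωint
  let ω : O := ⟨⟨(1 + s) / 2, hωmem⟩, hωint'⟩
  have hφω : φ ω = (1 + s) / 2 := rfl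
  let B : Module.Basis (Fin 2) ℤ O := Module.Basis.mk (v := ![1, ω]) (by
      rw [LinearIndependent.pair_iff]
      intro m n hmn
      have h1 : (m : ℂ) + n * ((1 + s) / 2) = 0 := by
        have := congrArg φ hmn
        simpa [hφω] using this
      have h2 := congrArg (starRingEnd ℂ) h1
      simp only [map_add, map_mul, map_div₀, map_one, hsconj, map_zero, map_intCast,
        map_ofNat] at h2
      have h3 : (n : ℂ) * s = 0 := by linear_combination h1 - h2
      have h4 : (n : ℂ) = 0 := (mul_eq_zero.mp h3).resolve_right hs0
      rw [h4] at h1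
      have h5 : (m : ℂ) = 0 := by linear_combination h1
      exact ⟨by exact_mod_cast h5, by exact_mod_cast h4⟩) (by
      rintro x -
      obtain ⟨m, n, hmn⟩ := exists_int_coords_of_isIntegral hneg h4 hsq hs
        (z := φ x) x.1.2 (x.2.map (IntermediateField.val (quadField Δ)|>.restrictScalars ℤ))
      rw [Matrix.range_cons, Matrix.range_cons, Matrix.range_empty, Set.union_empty,
        Set.singleton_union, Submodule.mem_span_pair]
      refine ⟨m, n, hφ ?_⟩
      rw [hmn]
      simp [hφω])
  have hB0 : φ (B 0) = 1 := by simp [B]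
  have hB1 : φ (B 1) = (1 + s) / 2 := by simp [B, hφω]
  obtain ⟨g, hg⟩ := exists_prime_orderOf_dvd_card' (G := ClassGroup O) 3 h3
  obtain ⟨⟨I, hI⟩, rfl⟩ := ClassGroup.mk0_surjective g
  have hnp : ¬ Submodule.IsPrincipal I := by
    rw [← ClassGroup.mk0_eq_one_iff hI]
    intro h1
    rw [h1, orderOf_one] at hg
    omega
  have hp3 : Submodule.IsPrincipal (I ^ 3) := by
    rw [← ClassGroup.mk0_eq_one_iff (pow_mem hI 3)]
    have := pow_orderOf_eq_one (ClassGroup.mk0 ⟨I, hI⟩)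
    rw [hg, ← map_pow] at this
    exact this
  rw [hk]
  exact exists_cubicDisc_eq_of_ideal B φ hφ s k (by omega) (by rw [hs, hk]) hsconj hB0 hB1
    (hk ▸ hsq) I hnp hp3

/-- The number of binary cubic forms modulo `m` with Hessian discriminant `δ`. -/
noncomputable def localCount (m : ℕ) [NeZero m] (δ : ZMod m) : ℕ :=
  (Finset.univ.filter fun v : ZMod m × ZMod m × ZMod m × ZMod m =>
    cubicDisc v.1 v.2.1 v.2.2.1 v.2.2.2 = δ).card

lemma cubicDisc_map {R S : Type*} [CommRing R] [CommRing S] (f : R →+* S) (a b c d : R) :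
    f (cubicDisc a b c d) = cubicDisc (f a) (f b) (f c) (f d) := by
  simp [cubicDisc, map_ofNat]

/-- The covariant `a² d - 3abc + 2b³` of a binary cubic form. -/
def cubicCov {R : Type*} [CommRing R] (a b c d : R) : R := a ^ 2 * d - 3 * a * b * c + 2 * b ^ 3

lemma cubic_syzygy {R : Type*} [CommRing R] (a b c d : R) :
    cubicCov a b c d ^ 2 - 4 * (b ^ 2 - a * c) ^ 3 = a ^ 2 * cubicDisc a b c d := by
  unfold cubicCov cubicDisc; ring

lemma cubic_eq_of_covariants {R : Type*} [CommRing R] {a b c d c' d' : R} (ha : IsUnit a)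
    (hA : b ^ 2 - a * c = b ^ 2 - a * c') (hD : cubicCov a b c d = cubicCov a b c' d') :
    c = c' ∧ d = d' := by
  have hc : c = c' := ha.mul_left_cancel (by linear_combination -hA)
  subst hc
  refine ⟨rfl, (ha.pow 2).mul_left_cancel ?_⟩
  unfold cubicCov at hD
  linear_combination hD

lemma localCount_prime_le (p : ℕ) [Fact p.Prime] (hp : p ≠ 2) (δ : ZMod p) (hδ : δ ≠ 0) :
    localCount p δ ≤ p ^ 3 := by
  classical
  have h2 : (2 : ZMod p) ≠ 0 := by
    intro h
    have h' : ((2 : ℕ) : ZMod p) = 0 := by exact_mod_cast h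
    rw [ZMod.natCast_eq_zero_iff] at h'
    exact hp ((Nat.prime_dvd_prime_iff_eq Fact.out Nat.prime_two).mp h')
  have h4 : (4 : ZMod p) ≠ 0 := by
    rw [show (4 : ZMod p) = 2 * 2 by norm_num]; exact mul_ne_zero h2 h2
  let f : ZMod p × ZMod p × ZMod p × ZMod p → ZMod p × ZMod p × ZMod p := fun v =>
    if v.1 = 0 then (v.2.1, 0, v.2.2.1)
    else if v.2.1 ^ 2 - v.1 * v.2.2.1 = 0 then
      (v.2.1, v.1, cubicCov v.1 v.2.1 v.2.2.1 v.2.2.2 / v.1)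
    else (v.2.1, v.1 / (v.2.1 ^ 2 - v.1 * v.2.2.1), cubicCov v.1 v.2.1 v.2.2.1 v.2.2.2 / v.1)
  have hcard : (Finset.univ : Finset (ZMod p × ZMod p × ZMod p)).card = p ^ 3 := by
    simp [Finset.card_univ, Fintype.card_prod, ZMod.card]; ring
  rw [← hcard]
  refine Finset.card_le_card_of_injOn f (fun _ _ => Finset.mem_coe.mpr (Finset.mem_univ _)) ?_
  rintro ⟨a, b, c, d⟩ hv ⟨a', b', c', d'⟩ hv' hf
  simp only [Finset.coe_filter, Finset.mem_univ, true_and, Set.mem_ofPred_eq] at hv hv'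
  have key : ∀ {a b c d : ZMod p}, a ≠ 0 → cubicDisc a b c d = δ →
      (cubicCov a b c d / a) ^ 2 - δ = 4 * (b ^ 2 - a * c) ^ 3 / a ^ 2 := by
    intro a b c d ha h
    have := cubic_syzygy a b c d
    rw [h] at this
    field_simp
    linear_combination this
  by_cases ha : a = 0 <;> by_cases ha' : a' = 0
  · simp only [f, ha, ha', if_true, Prod.mk.injEq, true_and] at hf
    obtain ⟨rfl, rfl⟩ := hf
    subst ha ha'
    have hb : b ≠ 0 := by
      rintro rfl
      apply hδ; rw [← hv]; simp [cubicDisc]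
    have : 4 * b ^ 3 * d = 4 * b ^ 3 * d' := by
      rw [← hv'] at hv
      unfold cubicDisc at hv
      linear_combination hv
    rw [mul_left_cancel₀ (mul_ne_zero h4 (pow_ne_zero 3 hb)) this]
  · exfalso
    by_cases hA : b' ^ 2 - a' * c' = 0 <;> simp [f, ha, ha', hA] at hf
    · exact ha' hf.2.1.symm
    · exact div_ne_zero ha' hA hf.2.1.symm
  · exfalso
    by_cases hA : b ^ 2 - a * c = 0 <;> simp [f, ha, ha', hA] at hf
  · have e1 := key ha hv
    have e2 := key ha' hv'
    by_cases hA : b ^ 2 - a * c = 0 <;> by_cases hA' : b' ^ 2 - a' * c' = 0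
    · simp only [f, ha, ha', hA, hA', if_true, if_false, Prod.mk.injEq] at hf
      obtain ⟨rfl, rfl, h3⟩ := hf
      obtain ⟨rfl, rfl⟩ := cubic_eq_of_covariants (b := b) (IsUnit.mk0 a ha) (hA.trans hA'.symm)
        ((div_left_inj' ha).mp h3)
      rfl
    · exfalso
      simp only [f, ha, ha', hA, hA', if_true, if_false, Prod.mk.injEq] at hf
      rw [← hf.2.2, e1, hA] at e2
      have : 4 * (b' ^ 2 - a' * c') ^ 3 / a' ^ 2 ≠ 0 :=
        div_ne_zero (mul_ne_zero h4 (pow_ne_zero 3 hA')) (pow_ne_zero 2 ha')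
      apply this; rw [← e2]; simp
    · exfalso
      simp only [f, ha, ha', hA, hA', if_true, if_false, Prod.mk.injEq] at hf
      rw [hf.2.2, e2, hA'] at e1
      have : 4 * (b ^ 2 - a * c) ^ 3 / a ^ 2 ≠ 0 :=
        div_ne_zero (mul_ne_zero h4 (pow_ne_zero 3 hA)) (pow_ne_zero 2 ha)
      apply this; rw [← e1]; simp
    · simp only [f, ha, ha', hA, hA', if_false, Prod.mk.injEq] at hf
      obtain ⟨rfl, h2, h3⟩ := hf
      rw [← h3, e1] at e2
      set A := b ^ 2 - a * c with hAdef
      set A' := b ^ 2 - a' * c' with hAdef'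
      have hAA : A = A' := by
        have s1 : 4 * A = (a / A) ^ 2 * (4 * A ^ 3 / a ^ 2) := by field_simp
        have s2 : 4 * A' = (a' / A') ^ 2 * (4 * A' ^ 3 / a' ^ 2) := by field_simp
        rw [h2, e2, ← s2] at s1
        exact mul_left_cancel₀ h4 s1
      have haa : a = a' := by
        rw [hAA] at h2
        exact (div_left_inj' hA').mp h2
      subst haa
      obtain ⟨rfl, rfl⟩ := cubic_eq_of_covariants (b := b) (IsUnit.mk0 a ha) hAA
        ((div_left_inj' ha).mp h3)
      rfl

lemma localCount_sq_le (p : ℕ) [Fact p.Prime] (hp : p ≠ 2) :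
    localCount (p ^ 2) (p : ZMod (p ^ 2)) ≤ (p ^ 2) ^ 3 := by
  classical
  have hpp : p.Prime := Fact.out
  set R := ZMod (p ^ 2) with hR
  have hunit : ∀ x : R, IsUnit x ∨ ∃ y : R, x = p * y := by
    intro x
    obtain ⟨n, rfl⟩ := ZMod.natCast_zmod_surjective x
    by_cases h : p ∣ n
    · obtain ⟨k, rfl⟩ := h
      exact Or.inr ⟨k, by push_cast; ring⟩
    · refine Or.inl ((ZMod.isUnit_iff_coprime _ _).mpr ?_)
      exact Nat.Coprime.pow_right 2 ((Nat.Prime.coprime_iff_not_dvd hpp).mpr h).symm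
  have hpi2 : (p : R) * p = 0 := by
    have : ((p ^ 2 : ℕ) : R) = 0 := ZMod.natCast_self _
    rw [← this]; push_cast; ring
  have hpi0 : (p : R) ≠ 0 := by
    intro h
    rw [ZMod.natCast_eq_zero_iff] at h
    exact hpp.one_lt.not_ge (by
      have := Nat.le_of_dvd hpp.pos h
      nlinarith [hpp.pos])
  have hnt : Nontrivial R := ⟨⟨_, _, hpi0⟩⟩
  have hnu : ∀ y : R, ¬ IsUnit ((p : R) * y) := by
    intro y h
    have h' : IsUnit (p : R) := isUnit_of_mul_isUnit_left h
    exact hpi0 (h'.mul_left_cancel (by rw [hpi2, mul_zero]))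
  have hmul : ∀ {x y : R}, ¬ IsUnit x → ¬ IsUnit y → x * y = 0 := by
    intro x y hx hy
    obtain ⟨u, rfl⟩ := (hunit x).resolve_left hx
    obtain ⟨v, rfl⟩ := (hunit y).resolve_left hy
    linear_combination u * v * hpi2
  have hadd : ∀ {x y : R}, IsUnit x → ¬ IsUnit y → IsUnit (x + y) := by
    intro x y hx hy
    have := (show IsNilpotent y from ⟨2, by rw [pow_two, hmul hy hy]⟩)
    exact IsNilpotent.isUnit_add_left_of_commute this hx (Commute.all _ _)
  have hnn : ∀ {x y : R}, ¬ IsUnit x → ¬ IsUnit (x * y) := fun hx h =>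
    hx (isUnit_of_mul_isUnit_left h)
  have h2 : IsUnit (2 : R) := by
    have : IsUnit ((2 : ℕ) : R) := by
      rw [ZMod.isUnit_iff_coprime]
      exact Nat.Coprime.pow_right 2 ((Nat.coprime_primes Nat.prime_two hpp).mpr (Ne.symm hp))
    simpa using this
  have h4 : IsUnit (4 : R) := by
    rw [show (4 : R) = 2 * 2 by norm_num]; exact h2.mul h2
  have hpin : ¬ IsUnit (p : R) := by simpa using hnu 1
  -- units in the generic case
  have hA : ∀ {a b c d : R}, IsUnit a → cubicDisc a b c d = p →
      IsUnit (b ^ 2 - a * c) ∧ IsUnit (cubicCov a b c d) := by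
    intro a b c d ha h
    have hs := cubic_syzygy a b c d
    rw [h] at hs
    have hAu : IsUnit (b ^ 2 - a * c) := by
      by_contra hAn
      have hA3 : (b ^ 2 - a * c) ^ 3 = 0 := by
        linear_combination (b ^ 2 - a * c) * hmul hAn hAn
      rw [hA3, mul_zero, sub_zero] at hs
      by_cases hD : IsUnit (cubicCov a b c d)
      · have : IsUnit (a ^ 2 * (p : R)) := hs ▸ hD.pow 2
        exact hpin (isUnit_of_mul_isUnit_right this)
      · rw [pow_two (cubicCov a b c d), hmul hD hD] at hs
        exact hpi0 ((ha.pow 2).mul_left_cancel (by rw [← hs, mul_zero]))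
    refine ⟨hAu, ?_⟩
    have h' : IsUnit (cubicCov a b c d ^ 2) := by
      have : cubicCov a b c d ^ 2 = 4 * (b ^ 2 - a * c) ^ 3 + p * a ^ 2 := by
        linear_combination hs
      rw [this]
      exact hadd (h4.mul (hAu.pow 3)) (hnu _)
    exact (isUnit_pow_iff two_ne_zero).mp h'
  let f : R × R × R × R → R × R × R := fun v =>
    if IsUnit v.1 then
      (v.2.1, v.1 * Ring.inverse (v.2.1 ^ 2 - v.1 * v.2.2.1),
        cubicCov v.1 v.2.1 v.2.2.1 v.2.2.2 * Ring.inverse v.1)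
    else if IsUnit v.2.1 then (v.2.2.1, v.1, v.2.1)
    else (v.2.2.2, v.2.2.1, v.2.1)
  have hcard : (Finset.univ : Finset (R × R × R)).card = (p ^ 2) ^ 3 := by
    simp [hR, Finset.card_univ, Fintype.card_prod, ZMod.card]; ring
  rw [← hcard]
  refine Finset.card_le_card_of_injOn f (fun _ _ => Finset.mem_coe.mpr (Finset.mem_univ _)) ?_
  rintro ⟨a, b, c, d⟩ hv ⟨a', b', c', d'⟩ hv' hf
  simp only [Finset.coe_filter, Finset.mem_univ, true_and, Set.mem_ofPred_eq] at hv hv'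
  have f1 : ∀ {a b c d : R}, IsUnit a → f (a, b, c, d) =
      (b, a * Ring.inverse (b ^ 2 - a * c), cubicCov a b c d * Ring.inverse a) := fun h =>
    if_pos h
  have f2 : ∀ {a b c d : R}, ¬ IsUnit a → IsUnit b → f (a, b, c, d) = (c, a, b) :=
    fun h h' => (if_neg h).trans (if_pos h')
  have f3 : ∀ {a b c d : R}, ¬ IsUnit a → ¬ IsUnit b → f (a, b, c, d) = (d, c, b) :=
    fun h h' => (if_neg h).trans (if_neg h')
  have hc : ∀ {a b c d : R}, ¬ IsUnit a → ¬ IsUnit b → cubicDisc a b c d = p →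
      4 * a * c ^ 3 = p ∧ IsUnit c := by
    intro a b c d ha hb h
    have hab := hmul ha hb
    have haa := hmul ha ha
    have hbb := hmul hb hb
    have e : 4 * a * c ^ 3 = p := by
      rw [← h]; unfold cubicDisc
      linear_combination (-d^2) * haa + (6*c*d) * hab + (3*c^2-4*b*d) * hbb
    refine ⟨e, ?_⟩
    by_contra hc
    apply hpi0
    rw [← e, show 4 * a * c ^ 3 = 4 * (a * c) * c ^ 2 by ring, hmul ha hc]; ring
  by_cases ha : IsUnit a <;> by_cases ha' : IsUnit a'
  · rw [f1 ha, f1 ha'] at hf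
    simp only [Prod.mk.injEq] at hf
    obtain ⟨rfl, h5, h6⟩ := hf
    obtain ⟨uA, uD⟩ := hA ha hv
    obtain ⟨uA', uD'⟩ := hA ha' hv'
    have main : ∀ {a c d : R}, IsUnit a → IsUnit (b ^ 2 - a * c) → cubicDisc a b c d = p →
        4 * (b ^ 2 - a * c) = (a * Ring.inverse (b ^ 2 - a * c)) ^ 2 *
          ((cubicCov a b c d * Ring.inverse a) ^ 2 - p) := by
      intro a c d ha uA h
      have hs := cubic_syzygy a b c d
      rw [h] at hs
      have i1 := Ring.mul_inverse_cancel _ ha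
      have i2 := Ring.mul_inverse_cancel _ uA
      set A := b ^ 2 - a * c
      set u := Ring.inverse a
      set v := Ring.inverse A
      set D := cubicCov a b c d
      have e1 : (a * v) ^ 2 * ((D * u) ^ 2 - p) = v ^ 2 * (D ^ 2 - a ^ 2 * p) := by
        linear_combination (v ^ 2 * D ^ 2 * (a * u + 1)) * i1
      have e2 : v ^ 2 * (4 * A ^ 3) = 4 * A := by
        linear_combination (4 * A * (A * v + 1)) * i2
      rw [e1, ← e2, show D ^ 2 - a ^ 2 * p = 4 * A ^ 3 by linear_combination hs]
    have hAA : b ^ 2 - a * c = b ^ 2 - a' * c' := by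
      apply h4.mul_left_cancel
      rw [main ha uA hv, main ha' uA' hv', h5, h6]
    have haa : a = a' := by
      rw [hAA] at h5
      exact (uA'.ringInverse).mul_right_cancel h5
    subst haa
    obtain ⟨rfl, rfl⟩ := cubic_eq_of_covariants (b := b) ha hAA
      ((ha.ringInverse).mul_right_cancel h6)
    rfl
  · exfalso
    by_cases hb' : IsUnit b'
    · rw [f1 ha, f2 ha' hb'] at hf
      simp only [Prod.mk.injEq] at hf
      apply ha'
      rw [← hf.2.1]
      exact ha.mul (hA ha hv).1.ringInverse
    · rw [f1 ha, f3 ha' hb'] at hf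
      simp only [Prod.mk.injEq] at hf
      apply hb'
      rw [← hf.2.2]
      exact (hA ha hv).2.mul ha.ringInverse
  · exfalso
    by_cases hb : IsUnit b
    · rw [f1 ha', f2 ha hb] at hf
      simp only [Prod.mk.injEq] at hf
      apply ha
      rw [hf.2.1]
      exact ha'.mul (hA ha' hv').1.ringInverse
    · rw [f1 ha', f3 ha hb] at hf
      simp only [Prod.mk.injEq] at hf
      apply hb
      rw [hf.2.2]
      exact (hA ha' hv').2.mul ha'.ringInverse
  · by_cases hb : IsUnit b <;> by_cases hb' : IsUnit b'
    · rw [f2 ha hb, f2 ha' hb'] at hf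
      simp only [Prod.mk.injEq] at hf
      obtain ⟨rfl, rfl, rfl⟩ := hf
      have e : (a ^ 2 * (d + d') + 4 * b ^ 3 - 6 * a * b * c) * d =
          (a ^ 2 * (d + d') + 4 * b ^ 3 - 6 * a * b * c) * d' := by
        rw [← hv'] at hv
        unfold cubicDisc at hv
        linear_combination hv
      have hu : IsUnit (a ^ 2 * (d + d') + 4 * b ^ 3 - 6 * a * b * c) := by
        rw [show a ^ 2 * (d + d') + 4 * b ^ 3 - 6 * a * b * c =
          4 * b ^ 3 + a * (a * (d + d') - 6 * b * c) by ring]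
        exact hadd (h4.mul (hb.pow 3)) (hnn ha)
      rw [hu.mul_left_cancel e]
    · exfalso
      rw [f2 ha hb, f3 ha' hb'] at hf
      simp only [Prod.mk.injEq] at hf
      exact ha (hf.2.1 ▸ (hc ha' hb' hv').2)
    · exfalso
      rw [f3 ha hb, f2 ha' hb'] at hf
      simp only [Prod.mk.injEq] at hf
      exact ha' (hf.2.1 ▸ (hc ha hb hv).2)
    · rw [f3 ha hb, f3 ha' hb'] at hf
      simp only [Prod.mk.injEq] at hf
      obtain ⟨rfl, rfl, rfl⟩ := hf
      obtain ⟨e1, u1⟩ := hc ha hb hv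
      obtain ⟨e2, -⟩ := hc ha' hb' hv'
      have : a = a' := by
        apply (h4.mul (u1.pow 3)).mul_left_cancel
        linear_combination e1 - e2
      rw [this]

lemma localCount_four : localCount 4 1 ≤ 96 := by
  unfold localCount cubicDisc
  decide +kernel

lemma localCount_mul {m n : ℕ} [NeZero m] [NeZero n] [NeZero (m * n)] (h : m.Coprime n)
    (δ : ℤ) : localCount (m * n) (δ : ZMod (m * n)) ≤
      localCount m (δ : ZMod m) * localCount n (δ : ZMod n) := by
  classical
  let e := ZMod.chineseRemainder h
  let φ : ZMod (m * n) →+* ZMod m := (RingHom.fst _ _).comp e.toRingHom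
  let ψ : ZMod (m * n) →+* ZMod n := (RingHom.snd _ _).comp e.toRingHom
  have hinj : ∀ {x y}, φ x = φ y → ψ x = ψ y → x = y := fun h1 h2 =>
    e.injective (Prod.ext h1 h2)
  unfold localCount
  rw [← Finset.card_product]
  refine Finset.card_le_card_of_injOn (fun v =>
    ((φ v.1, φ v.2.1, φ v.2.2.1, φ v.2.2.2), (ψ v.1, ψ v.2.1, ψ v.2.2.1, ψ v.2.2.2))) ?_ ?_
  · intro v hv
    simp only [Finset.coe_filter, Finset.mem_univ, true_and, Set.mem_ofPred_eq] at hv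
    simp only [Finset.coe_product, Set.mem_prod, Finset.coe_filter, Finset.mem_univ, true_and,
      Set.mem_ofPred_eq, ← cubicDisc_map, hv, map_intCast]
  · rintro ⟨a, b, c, d⟩ - ⟨a', b', c', d'⟩ - hf
    simp only [Prod.mk.injEq] at hf ⊢
    obtain ⟨⟨h1, h2, h3, h4⟩, h5, h6, h7, h8⟩ := hf
    exact ⟨hinj h1 h5, hinj h2 h6, hinj h3 h7, hinj h4 h8⟩

lemma exists_local_prime (p : ℕ) (hp : p.Prime) (hp2 : p ≠ 2) (t : SplittingType) :
    ∃ k : ℕ, ∃ _ : NeZero (p ^ k), ∃ δ : ℤ, k ≠ 0 ∧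
      localCount (p ^ k) (δ : ZMod (p ^ k)) ≤ (p ^ k) ^ 3 ∧
      ∀ Δ : ℤ, Δ ≡ δ [ZMOD (p ^ k : ℕ)] → HasSplittingType p Δ t ∧ ¬ (p : ℤ) ^ 2 ∣ Δ := by
  have hF : Fact p.Prime := ⟨hp⟩
  have hsq : ∀ Δ : ℤ, (p : ℤ) ^ 2 ∣ Δ → (p : ℤ) ∣ Δ := fun Δ h =>
    (dvd_pow_self (p : ℤ) two_ne_zero).trans h
  have unr : ∀ δ : ℤ, (δ : ZMod p) ≠ 0 →
      (∀ Δ : ℤ, (Δ : ZMod p) = δ → HasSplittingType p Δ t) →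
      ∃ k : ℕ, ∃ _ : NeZero (p ^ k), ∃ δ : ℤ, k ≠ 0 ∧
        localCount (p ^ k) (δ : ZMod (p ^ k)) ≤ (p ^ k) ^ 3 ∧
        ∀ Δ : ℤ, Δ ≡ δ [ZMOD (p ^ k : ℕ)] → HasSplittingType p Δ t ∧ ¬ (p : ℤ) ^ 2 ∣ Δ := by
    intro δ hδ h
    have hone : p ^ 1 = p := pow_one p
    refine ⟨1, inferInstance, δ, one_ne_zero, ?_, ?_⟩
    · have key : ∀ (q : ℕ) [NeZero q], q = p → localCount q (δ : ZMod q) ≤ q ^ 3 := by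
        rintro q hq rfl
        exact localCount_prime_le q hp2 _ hδ
      exact key _ hone
    · intro Δ hΔ
      rw [hone, ← ZMod.intCast_eq_intCast_iff] at hΔ
      refine ⟨h Δ hΔ, fun h2 => hδ ?_⟩
      rw [← hΔ, ZMod.intCast_zmod_eq_zero_iff_dvd]
      exact hsq Δ h2
  cases t with
  | split =>
    refine unr 1 (by simp) fun Δ hΔ => ?_
    simp only [HasSplittingType, hp, dif_pos]
    rw [legendreSym.eq_one_iff p (by rw [hΔ]; simp), hΔ]
    simp
  | inert =>
    have hchar : ringChar (ZMod p) ≠ 2 := by rwa [ZMod.ringChar_zmod_n]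
    obtain ⟨r, hr⟩ := FiniteField.exists_nonsquare hchar
    obtain ⟨δ, rfl⟩ := ZMod.intCast_surjective r
    refine unr δ (fun h => hr (by rw [h]; exact IsSquare.zero)) fun Δ hΔ => ?_
    simp only [HasSplittingType, hp, dif_pos]
    rw [legendreSym.eq_neg_one_iff, hΔ]
    exact hr
  | ramified =>
    refine ⟨2, inferInstance, p, two_ne_zero, ?_, fun Δ hΔ => ?_⟩
    · simpa using localCount_sq_le p hp2
    · obtain ⟨k, hk⟩ := hΔ.symm.dvd
      have e : Δ = p * (1 + p * k) := by push_cast at hk; linear_combination hk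
      refine ⟨⟨_, e⟩, ?_⟩
      rw [e, pow_two]
      intro h
      have h1 : (p : ℤ) ∣ 1 + p * k :=
        (mul_dvd_mul_iff_left (by exact_mod_cast hp.ne_zero)).mp h
      have h2 : (p : ℤ) ∣ 1 := (dvd_add_left (dvd_mul_right _ _)).mp h1
      exact hp.one_lt.ne' (by exact_mod_cast Int.eq_one_of_dvd_one (by positivity) h2)

lemma exists_local (σ : ℕ → SplittingType) (S : Finset ℕ) (hS : ∀ p ∈ S, p.Prime ∧ p ≠ 2) :
    ∃ m : ℕ, ∃ _ : NeZero m, ∃ δ : ℤ, localCount m (δ : ZMod m) ≤ m ^ 3 ∧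
      (∀ q : ℕ, q.Prime → q ∣ m → q ∈ S) ∧
      ∀ Δ : ℤ, Δ ≡ δ [ZMOD m] → (∀ p ∈ S, HasSplittingType p Δ (σ p)) ∧
        ∀ q : ℕ, q.Prime → q ∣ m → ¬ (q : ℤ) ^ 2 ∣ Δ := by
  classical
  induction S using Finset.induction_on with
  | empty =>
    refine ⟨1, inferInstance, 0, ?_, ?_, ?_⟩
    · refine (Finset.card_le_univ _).trans ?_
      simp
    · intro q hq h
      exact absurd (Nat.dvd_one.mp h) hq.one_lt.ne'
    · intro Δ _
      exact ⟨by simp, fun q hq h => absurd (Nat.dvd_one.mp h) hq.one_lt.ne'⟩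
  | insert p S hpS ih =>
    obtain ⟨m, hm, δ, hN, hprime, hΔ⟩ := ih fun q hq => hS q (Finset.mem_insert_of_mem hq)
    obtain ⟨hp, hp2⟩ := hS p (Finset.mem_insert_self p S)
    obtain ⟨k, hk, ε, hk0, hN', hΔ'⟩ := exists_local_prime p hp hp2 (σ p)
    have hcop : m.Coprime (p ^ k) := by
      refine Nat.Coprime.pow_right k ((Nat.Prime.coprime_iff_not_dvd hp).mpr ?_).symm
      exact fun h => hpS (hprime p hp h)
    obtain ⟨u, v, huv⟩ := Nat.isCoprime_iff_coprime.mpr hcop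
    have hmk : NeZero (m * p ^ k) := ⟨mul_ne_zero hm.out hk.out⟩
    set η : ℤ := δ * (v * (p ^ k : ℕ)) + ε * (u * m) with hη
    have e1 : η ≡ δ [ZMOD m] := by
      refine (Int.modEq_iff_dvd.mpr ⟨(δ - ε) * u, ?_⟩)
      rw [hη]; linear_combination (-δ) * huv
    have e2 : η ≡ ε [ZMOD (p ^ k : ℕ)] := by
      refine (Int.modEq_iff_dvd.mpr ⟨(ε - δ) * v, ?_⟩)
      rw [hη]; linear_combination (-ε) * huv
    refine ⟨m * p ^ k, hmk, η, ?_, ?_, ?_⟩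
    · refine (localCount_mul hcop η).trans ?_
      rw [(ZMod.intCast_eq_intCast_iff _ _ _).mpr e1, (ZMod.intCast_eq_intCast_iff _ _ _).mpr e2,
        mul_pow]
      exact Nat.mul_le_mul hN hN'
    · intro q hq h
      rcases (Nat.Prime.dvd_mul hq).mp h with h | h
      · exact Finset.mem_insert_of_mem (hprime q hq h)
      · rw [(Nat.prime_dvd_prime_iff_eq hq hp).mp (hq.dvd_of_dvd_pow h)]
        exact Finset.mem_insert_self p S
    · intro Δ h
      push_cast at h
      have h1 := (h.of_mul_right _).trans e1
      have h2 : Δ ≡ ε [ZMOD (p ^ k : ℕ)] := by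
        push_cast; push_cast at e2; exact (h.of_mul_left _).trans e2
      obtain ⟨g1, g2⟩ := hΔ Δ h1
      obtain ⟨g3, g4⟩ := hΔ' Δ h2
      refine ⟨fun q hq => ?_, fun q hq h => ?_⟩
      · rcases Finset.mem_insert.mp hq with rfl | hq
        exacts [g3, g1 q hq]
      · rcases (Nat.Prime.dvd_mul hq).mp h with h | h
        · exact g2 q hq h
        · rw [(Nat.prime_dvd_prime_iff_eq hq hp).mp (hq.dvd_of_dvd_pow h)]
          exact g4

/-- The residue class of discriminants used for the proportion: it forces the splitting types,
oddness and squarefreeness at the primes dividing the modulus. -/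
lemma exists_residue_class (σ : ℕ → SplittingType) (S : Finset ℕ)
    (hS : ∀ p ∈ S, p.Prime ∧ p ≠ 2) :
    ∃ m : ℕ, ∃ _ : NeZero m, ∃ δ : ℤ, 2 * localCount m (δ : ZMod m) ≤ 3 * m ^ 3 ∧ 2 ∣ m ∧
      ∀ Δ : ℤ, Δ ≡ δ [ZMOD m] → Δ % 4 = 1 ∧ (∀ p ∈ S, HasSplittingType p Δ (σ p)) ∧
        ∀ q : ℕ, q.Prime → q ∣ m → ¬ (q : ℤ) ^ 2 ∣ Δ := by
  obtain ⟨m, hm, δ, hN, hprime, hΔ⟩ := exists_local σ S hS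
  have hcop : (4 : ℕ).Coprime m := by
    rw [show 4 = 2 ^ 2 by norm_num]
    refine Nat.Coprime.pow_left 2 ((Nat.Prime.coprime_iff_not_dvd Nat.prime_two).mpr ?_)
    exact fun h => (hS 2 (hprime 2 Nat.prime_two h)).2 rfl
  obtain ⟨u, v, huv⟩ := Nat.isCoprime_iff_coprime.mpr hcop
  have hmk : NeZero (4 * m) := ⟨mul_ne_zero four_ne_zero hm.out⟩
  set η : ℤ := δ * (u * 4) + v * m with hη
  have e1 : η ≡ δ [ZMOD m] := by
    refine (Int.modEq_iff_dvd.mpr ⟨(δ - 1) * v, ?_⟩)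
    push_cast at huv
    rw [hη]; linear_combination (-δ) * huv
  have e2 : η ≡ 1 [ZMOD (4 : ℕ)] := by
    refine (Int.modEq_iff_dvd.mpr ⟨(1 - δ) * u, ?_⟩)
    push_cast at huv ⊢
    rw [hη]; linear_combination (-1) * huv
  refine ⟨4 * m, hmk, η, ?_, ⟨2 * m, by ring⟩, fun Δ h => ?_⟩
  · have := localCount_mul hcop η
    rw [(ZMod.intCast_eq_intCast_iff _ _ _).mpr e1, (ZMod.intCast_eq_intCast_iff _ _ _).mpr e2]
      at this
    have h4 : localCount 4 ((1 : ℤ) : ZMod 4) ≤ 96 := by simpa using localCount_four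
    have := this.trans (Nat.mul_le_mul h4 hN)
    have e : (4 * m) ^ 3 = 64 * m ^ 3 := by ring
    omega
  · push_cast at h e2
    have h2 : Δ ≡ 1 [ZMOD 4] := (h.of_mul_right _).trans e2
    obtain ⟨g1, g2⟩ := hΔ Δ ((h.of_mul_left _).trans e1)
    have h4 : Δ % 4 = 1 := h2
    refine ⟨h4, g1, fun q hq hd => ?_⟩
    rcases (Nat.Prime.dvd_mul hq).mp hd with hd | hd
    · rw [(Nat.prime_dvd_prime_iff_eq hq Nat.prime_two).mp
        (hq.dvd_of_dvd_pow (show q ∣ 2 ^ 2 from hd))]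
      push_cast
      omega
    · exact g2 q hq hd

open MeasureTheory Set in
/-- Points of an arithmetic progression carry disjoint intervals of length the modulus. -/
lemma mul_sum_le_integral {g : ℝ → ℝ} {u v : ℝ} {q : ℕ} (s : ℝ) {𝒮 : Finset ℤ} (huv : u ≤ v)
    (hgi : IntervalIntegrable g volume u v) (hg : ∀ x, 0 ≤ g x)
    (hcong : ∀ n ∈ 𝒮, ∀ n' ∈ 𝒮, (q : ℤ) ∣ n - n') (hu : ∀ n ∈ 𝒮, u ≤ n + s)
    (hv : ∀ n ∈ 𝒮, n + s + q ≤ v)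
    (hle : ∀ n ∈ 𝒮, ∀ x ∈ Ioc (n + s : ℝ) (n + s + q), g n ≤ g x) :
    q * ∑ n ∈ 𝒮, g n ≤ ∫ x in u..v, g x := by
  have hI : IntegrableOn g (Ioc u v) := (intervalIntegrable_iff_integrableOn_Ioc_of_le huv).mp hgi
  have hsub : ∀ n ∈ 𝒮, Ioc (n + s : ℝ) (n + s + q) ⊆ Ioc u v := fun n hn =>
    Ioc_subset_Ioc (hu n hn) (hv n hn)
  have hdisj : (𝒮 : Set ℤ).Pairwise
      (Function.onFun Disjoint fun n : ℤ => Ioc (n + s : ℝ) (n + s + q)) := by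
    have aux : ∀ n ∈ 𝒮, ∀ n' ∈ 𝒮, n < n' →
        Disjoint (Ioc (n + s : ℝ) (n + s + q)) (Ioc (n' + s : ℝ) (n' + s + q)) := by
      intro n hn n' hn' hlt
      have h1 : (q : ℤ) ≤ n' - n := Int.le_of_dvd (by omega) (hcong n' hn' n hn)
      have h2 : (q : ℝ) ≤ n' - n := by exact_mod_cast h1
      rw [Set.disjoint_left]
      rintro x ⟨-, hx⟩ ⟨hx', -⟩
      linarith
    intro n hn n' hn' hne
    rcases lt_or_gt_of_ne hne with h | h
    · exact aux n hn n' hn' h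
    · exact (aux n' hn' n hn h).symm
  have hstep : ∀ n ∈ 𝒮, q * g n ≤ ∫ x in Ioc (n + s : ℝ) (n + s + q), g x := by
    intro n hn
    have : ∫ x in Ioc (n + s : ℝ) (n + s + q), g n = q * g n := by
      simp
    rw [← this]
    exact setIntegral_mono_on (by simp) (hI.mono_set (hsub n hn)) measurableSet_Ioc (hle n hn)
  calc q * ∑ n ∈ 𝒮, g n = ∑ n ∈ 𝒮, q * g n := Finset.mul_sum _ _ _
    _ ≤ ∑ n ∈ 𝒮, ∫ x in Ioc (n + s : ℝ) (n + s + q), g x := Finset.sum_le_sum hstep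
    _ = ∫ x in ⋃ n ∈ 𝒮, Ioc (n + s : ℝ) (n + s + q), g x :=
      (integral_biUnion_finset 𝒮 (fun _ _ => measurableSet_Ioc) hdisj
        fun n hn => hI.mono_set (hsub n hn)).symm
    _ ≤ ∫ x in Ioc u v, g x :=
      setIntegral_mono_set hI (Filter.Eventually.of_forall hg)
        (iUnion₂_subset hsub).eventuallyLE
    _ = ∫ x in u..v, g x := (intervalIntegral.integral_of_le huv).symm

lemma card_sub_one_mul_le {q : ℕ} (hq : 0 < q) {𝒮 : Finset ℤ} (hne : 𝒮.Nonempty)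
    (hcong : ∀ n ∈ 𝒮, ∀ n' ∈ 𝒮, (q : ℤ) ∣ n - n') :
    ∃ n₀ ∈ 𝒮, ∃ n₁ ∈ 𝒮, ((𝒮.card : ℤ) - 1) * q ≤ n₁ - n₀ := by
  have hq' : (0 : ℤ) < q := by exact_mod_cast hq
  refine ⟨𝒮.min' hne, 𝒮.min'_mem hne, 𝒮.max' hne, 𝒮.max'_mem hne, ?_⟩
  set n₀ := 𝒮.min' hne
  set n₁ := 𝒮.max' hne
  have hcard : 𝒮.card ≤ (Finset.Icc 0 ((n₁ - n₀) / q)).card := by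
    refine Finset.card_le_card_of_injOn (fun n => (n - n₀) / q) ?_ ?_
    · intro n hn
      have h0 : n₀ ≤ n := 𝒮.min'_le n hn
      have h1 : n ≤ n₁ := 𝒮.le_max' n hn
      simp only [Finset.coe_Icc, Set.mem_Icc]
      exact ⟨Int.ediv_nonneg (by omega) hq'.le, Int.ediv_le_ediv hq' (by omega)⟩
    · intro n hn n' hn' h
      have e1 := Int.ediv_mul_cancel (hcong n hn n₀ (𝒮.min'_mem hne))
      have e2 := Int.ediv_mul_cancel (hcong n' hn' n₀ (𝒮.min'_mem hne))
      simp only at h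
      rw [h] at e1
      linarith
  rw [Int.card_Icc] at hcard
  have h0 : 0 ≤ (n₁ - n₀) / q := Int.ediv_nonneg (by
    have := 𝒮.min'_le n₁ (𝒮.max'_mem hne)
    omega) hq'.le
  have h1 : (𝒮.card : ℤ) - 1 ≤ (n₁ - n₀) / q := by omega
  calc ((𝒮.card : ℤ) - 1) * q ≤ (n₁ - n₀) / q * q := by gcongr
    _ ≤ n₁ - n₀ := Int.ediv_mul_le _ hq'.ne'

lemma card_le_of_mem_Icc {q : ℕ} (hq : 0 < q) {𝒮 : Finset ℤ} {u v : ℝ} (huv : u ≤ v)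
    (hcong : ∀ n ∈ 𝒮, ∀ n' ∈ 𝒮, (q : ℤ) ∣ n - n') (hmem : ∀ n ∈ 𝒮, u ≤ n ∧ n ≤ v) :
    (𝒮.card : ℝ) ≤ (v - u) / q + 1 := by
  have hq' : (0 : ℝ) < q := by exact_mod_cast hq
  rcases 𝒮.eq_empty_or_nonempty with rfl | hne
  · simp only [Finset.card_empty, Nat.cast_zero]
    have := div_nonneg (sub_nonneg.mpr huv) hq'.le
    linarith
  · obtain ⟨n₀, h0, n₁, h1, h⟩ := card_sub_one_mul_le hq hne hcong
    have h' : ((𝒮.card : ℝ) - 1) * q ≤ n₁ - n₀ := by exact_mod_cast h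
    have : (𝒮.card : ℝ) - 1 ≤ (v - u) / q := by
      rw [le_div_iff₀ hq']
      linarith [(hmem n₀ h0).1, (hmem n₁ h1).2]
    linarith

open MeasureTheory Set in
lemma mul_sum_le_integral_of_unimodal {g : ℝ → ℝ} {m N B : ℝ} {q : ℕ} (hq : 0 < q)
    {𝒮 : Finset ℤ} (hm : 0 ≤ m) (hmN : m ≤ N) (hg : ∀ x, 0 ≤ g x)
    (hmono : MonotoneOn g (Icc 0 m)) (hanti : AntitoneOn g (Icc m N))
    (hmem : ∀ n ∈ 𝒮, 0 < n ∧ (n : ℝ) ≤ N)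
    (hcong : ∀ n ∈ 𝒮, ∀ n' ∈ 𝒮, (q : ℤ) ∣ n - n') (hB0 : 0 ≤ B) (hB : ∀ n ∈ 𝒮, g n ≤ B) :
    q * ∑ n ∈ 𝒮, g n ≤ (∫ x in (0 : ℝ)..N, g x) + 2 * q * B := by
  classical
  have hq' : (0 : ℝ) < q := by exact_mod_cast hq
  have i1 : IntervalIntegrable g volume 0 m :=
    MonotoneOn.intervalIntegrable (by rwa [uIcc_of_le hm])
  have i2 : IntervalIntegrable g volume m N :=
    AntitoneOn.intervalIntegrable (by rwa [uIcc_of_le hmN])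
  set 𝒮₁ := 𝒮.filter fun n : ℤ => (n : ℝ) + q ≤ m
  set 𝒮' := 𝒮.filter fun n : ℤ => ¬ (n : ℝ) + q ≤ m
  set 𝒮₂ := 𝒮'.filter fun n : ℤ => m ≤ (n : ℝ) - q
  set 𝒮₃ := 𝒮'.filter fun n : ℤ => ¬ m ≤ (n : ℝ) - q
  have hsplit : ∑ n ∈ 𝒮, g n = ∑ n ∈ 𝒮₁, g n + (∑ n ∈ 𝒮₂, g n + ∑ n ∈ 𝒮₃, g n) := by
    rw [Finset.sum_filter_add_sum_filter_not, Finset.sum_filter_add_sum_filter_not]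
  have s1 : ∀ n ∈ 𝒮₁, n ∈ 𝒮 ∧ (n : ℝ) + q ≤ m := fun n hn => Finset.mem_filter.mp hn
  have s2 : ∀ n ∈ 𝒮₂, n ∈ 𝒮 ∧ m ≤ (n : ℝ) - q := fun n hn =>
    ⟨(Finset.mem_filter.mp (Finset.mem_filter.mp hn).1).1, (Finset.mem_filter.mp hn).2⟩
  have s3 : ∀ n ∈ 𝒮₃, n ∈ 𝒮 ∧ m - q < (n : ℝ) ∧ (n : ℝ) < m + q := fun n hn => by
    obtain ⟨h1, h2⟩ := Finset.mem_filter.mp hn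
    obtain ⟨h3, h4⟩ := Finset.mem_filter.mp h1
    exact ⟨h3, by linarith, by linarith⟩
  have pos : ∀ n ∈ 𝒮, (0 : ℝ) < n := fun n hn => by exact_mod_cast (hmem n hn).1
  have b1 : q * ∑ n ∈ 𝒮₁, g n ≤ ∫ x in (0 : ℝ)..m, g x := by
    refine mul_sum_le_integral 0 hm i1 hg
      (fun n hn n' hn' => hcong n (s1 n hn).1 n' (s1 n' hn').1) ?_ ?_ ?_
    · intro n hn; linarith [pos n (s1 n hn).1]
    · intro n hn; linarith [(s1 n hn).2]
    · intro n hn x hx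
      have := pos n (s1 n hn).1
      have := (s1 n hn).2
      obtain ⟨hx1, hx2⟩ := hx
      exact hmono ⟨by linarith, by linarith⟩ ⟨by linarith, by linarith⟩ (by linarith)
  have b2 : q * ∑ n ∈ 𝒮₂, g n ≤ ∫ x in m..N, g x := by
    refine mul_sum_le_integral (-q) hmN i2 hg
      (fun n hn n' hn' => hcong n (s2 n hn).1 n' (s2 n' hn').1) ?_ ?_ ?_
    · intro n hn; linarith [(s2 n hn).2]
    · intro n hn; linarith [(hmem n (s2 n hn).1).2]
    · intro n hn x hx
      have := (hmem n (s2 n hn).1).2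
      have := (s2 n hn).2
      obtain ⟨hx1, hx2⟩ := hx
      exact hanti ⟨by linarith, by linarith⟩ ⟨by linarith, by linarith⟩ (by linarith)
  have c3 : (𝒮₃.card : ℝ) ≤ 2 := by
    rcases 𝒮₃.eq_empty_or_nonempty with h | hne
    · rw [h]; simp
    · obtain ⟨n₀, h0, n₁, h1, h⟩ := card_sub_one_mul_le hq hne
        fun n hn n' hn' => hcong n (s3 n hn).1 n' (s3 n' hn').1
      have h' : ((𝒮₃.card : ℝ) - 1) * q ≤ n₁ - n₀ := by exact_mod_cast h
      have h2 : ((𝒮₃.card : ℝ) - 1) * q < 2 * q := by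
        linarith [(s3 n₀ h0).2.1, (s3 n₁ h1).2.2]
      have h3 : (𝒮₃.card : ℝ) < 3 := by linarith [lt_of_mul_lt_mul_right h2 hq'.le]
      have : 𝒮₃.card < 3 := by exact_mod_cast h3
      exact_mod_cast Nat.lt_succ_iff.mp this
  have b3 : q * ∑ n ∈ 𝒮₃, g n ≤ 2 * q * B := by
    have : ∑ n ∈ 𝒮₃, g n ≤ 𝒮₃.card • B :=
      Finset.sum_le_card_nsmul _ _ _ fun n hn => hB n (s3 n hn).1
    rw [nsmul_eq_mul] at this
    have := this.trans (mul_le_mul_of_nonneg_right c3 hB0)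
    nlinarith
  rw [hsplit, ← intervalIntegral.integral_add_adjacent_intervals i1 i2]
  linarith

/-- The length of the interval of `D ≥ 0` with `81/100 w² ≤ K - D² ≤ w²`. -/
noncomputable def sqrtGap (K w : ℝ) : ℝ := √(K - 81 / 100 * w ^ 2) - √(K - w ^ 2)

lemma sqrtGap_nonneg (K w : ℝ) : 0 ≤ sqrtGap K w :=
  sub_nonneg.mpr (Real.sqrt_le_sqrt (by nlinarith [sq_nonneg w]))

lemma sqrtGap_le (K : ℝ) {w : ℝ} (hw : 0 ≤ w) : sqrtGap K w ≤ w := by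
  unfold sqrtGap
  rw [sub_le_iff_le_add]
  apply Real.sqrt_le_iff.mpr
  have h := Real.sqrt_nonneg (K - w ^ 2)
  refine ⟨by positivity, ?_⟩
  have h2 : K - w ^ 2 ≤ √(K - w ^ 2) ^ 2 := by
    rcases le_total 0 (K - w ^ 2) with h0 | h0
    · rw [Real.sq_sqrt h0]
    · exact h0.trans (sq_nonneg _)
  nlinarith [mul_nonneg hw h, sq_nonneg w]

lemma sqrtGap_eq_of_le {K w : ℝ} (h : K ≤ w ^ 2) : sqrtGap K w = √(K - 81 / 100 * w ^ 2) := by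
  unfold sqrtGap
  rw [Real.sqrt_eq_zero_of_nonpos (by linarith : K - w ^ 2 ≤ 0), sub_zero]

lemma sqrtGap_eq_div {K w : ℝ} (hK : 0 < K) (h : w ^ 2 ≤ K) :
    sqrtGap K w = 19 / 100 * w ^ 2 / (√(K - 81 / 100 * w ^ 2) + √(K - w ^ 2)) := by
  have h1 : 0 < K - 81 / 100 * w ^ 2 := by nlinarith [sq_nonneg w]
  have h2 : 0 ≤ K - w ^ 2 := by linarith
  have h3 := Real.sqrt_pos.mpr h1
  have h4 := Real.sqrt_nonneg (K - w ^ 2)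
  rw [eq_div_iff (by positivity)]
  unfold sqrtGap
  linear_combination Real.sq_sqrt h1.le - Real.sq_sqrt h2

lemma sqrtGap_mono_left {K K' w : ℝ} (hKK : K ≤ K') (h : K' ≤ w ^ 2) :
    sqrtGap K w ≤ sqrtGap K' w := by
  rw [sqrtGap_eq_of_le h, sqrtGap_eq_of_le (hKK.trans h)]
  exact Real.sqrt_le_sqrt (by linarith)

lemma sqrtGap_anti_left {K K' w : ℝ} (hKK : K ≤ K') (hK : 0 < K) (h : w ^ 2 ≤ K) :
    sqrtGap K' w ≤ sqrtGap K w := by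
  rw [sqrtGap_eq_div hK h, sqrtGap_eq_div (hK.trans_le hKK) (h.trans hKK)]
  have h1 : 0 < K - 81 / 100 * w ^ 2 := by nlinarith [sq_nonneg w]
  have h3 := Real.sqrt_pos.mpr h1
  have h4 := Real.sqrt_nonneg (K - w ^ 2)
  gcongr

lemma sqrtGap_div_sq_mono {K R : ℝ} (hK : 0 < K) (hR : 0 < R) :
    MonotoneOn (fun a : ℝ => sqrtGap K (a * R) / a ^ 2) (Set.Icc 0 (√K / R)) := by
  rintro a ⟨ha0, ha⟩ a' ⟨ha0', ha'⟩ haa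
  simp only
  rcases ha0.eq_or_lt with rfl | hpos
  · simp only [ne_eq, OfNat.ofNat_ne_zero, not_false_eq_true, zero_pow, div_zero]
    exact div_nonneg (sqrtGap_nonneg _ _) (sq_nonneg _)
  have hpos' := hpos.trans_le haa
  have hsq : ∀ x : ℝ, 0 < x → x ≤ √K / R → (x * R) ^ 2 ≤ K := fun x hx h => by
    rw [le_div_iff₀ hR] at h
    exact (Real.le_sqrt' (by positivity)).mp h
  have e : ∀ x : ℝ, 0 < x → x ≤ √K / R → sqrtGap K (x * R) / x ^ 2 =
      19 / 100 * R ^ 2 / (√(K - 81 / 100 * (x * R) ^ 2) + √(K - (x * R) ^ 2)) := by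
    intro x hx h
    rw [sqrtGap_eq_div hK (hsq x hx h), mul_pow]
    field_simp
  rw [e a hpos ha, e a' hpos' ha']
  have h2 := hsq a' hpos' ha'
  have h1 : 0 < K - 81 / 100 * (a' * R) ^ 2 := by nlinarith [sq_nonneg (a' * R)]
  have h3 := Real.sqrt_pos.mpr h1
  have h4 := Real.sqrt_nonneg (K - (a' * R) ^ 2)
  gcongr

lemma sqrtGap_div_sq_anti {K R : ℝ} (hK : 0 < K) (hR : 0 < R) :
    AntitoneOn (fun a : ℝ => sqrtGap K (a * R) / a ^ 2) (Set.Ici (√K / R)) := by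
  intro a ha a' ha' haa
  simp only [Set.mem_Ici] at ha ha'
  simp only
  have h0 : 0 < √K / R := div_pos (Real.sqrt_pos.mpr hK) hR
  have hpos : 0 < a := h0.trans_le ha
  have hsq : ∀ x : ℝ, √K / R ≤ x → K ≤ (x * R) ^ 2 := fun x h => by
    rw [div_le_iff₀ hR] at h
    exact (Real.sqrt_le_left (by
      exact mul_nonneg (h0.le.trans (by rwa [div_le_iff₀ hR])) hR.le)).mp h
  rw [sqrtGap_eq_of_le (hsq a ha), sqrtGap_eq_of_le (hsq a' ha')]
  gcongr

lemma sqrtGap_div_sq_le {K R : ℝ} (hK : 0 < K) (hR : 0 < R) {a : ℝ} (ha : 1 ≤ a) :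
    sqrtGap K (a * R) / a ^ 2 ≤ R / √(√K / R) := by
  have ha0 : 0 < a := by linarith
  set m := √K / R with hm
  have hm0 : 0 < m := div_pos (Real.sqrt_pos.mpr hK) hR
  have b : ∀ x : ℝ, 0 < x → sqrtGap K (x * R) / x ^ 2 ≤ R / x := by
    intro x hx
    rw [div_le_div_iff₀ (by positivity) hx]
    nlinarith [sqrtGap_le K (w := x * R) (by positivity)]
  have b1 : sqrtGap K (a * R) / a ^ 2 ≤ R :=
    (b a ha0).trans (div_le_self hR.le ha)
  have b2 : sqrtGap K (a * R) / a ^ 2 ≤ R / m := by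
    refine le_trans ?_ (b m hm0)
    rcases le_total a m with h | h
    · exact sqrtGap_div_sq_mono hK hR ⟨ha0.le, h⟩ ⟨hm0.le, le_rfl⟩ h
    · exact sqrtGap_div_sq_anti hK hR (Set.mem_Ici.mpr le_rfl) (Set.mem_Ici.mpr h) h
  have hs := Real.sqrt_pos.mpr hm0
  rcases le_total m 1 with h | h
  · refine b1.trans ?_
    rw [le_div_iff₀ hs]
    have : √m ≤ 1 := Real.sqrt_le_one.mpr h
    nlinarith
  · refine b2.trans ?_
    have : √m ≤ m := by
      rw [Real.sqrt_le_left hm0.le]; nlinarith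
    gcongr

open MeasureTheory Set in
lemma integral_sqrtGap_div_sq {K R N : ℝ} (hK : 0 < K) (hR : 0 < R) (hN : √K / (9 / 10 * R) ≤ N) :
    ∫ a in (0 : ℝ)..N, sqrtGap K (a * R) / a ^ 2 = Real.pi / 20 * R := by
  have hsK := Real.sqrt_pos.mpr hK
  set k := √K with hk
  have hkk : k ^ 2 = K := Real.sq_sqrt hK.le
  have hN1 : 0 < k / (9 / 10 * R) := by positivity
  have hN0 : 0 < N := hN1.trans_le hN
  have hmN : k / R ≤ N := le_trans (by gcongr; linarith) hN
  let q : ℝ → ℝ := fun a => √(K - (a * R) ^ 2) - √(K - 81 / 100 * (a * R) ^ 2)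
  let G : ℝ → ℝ := fun a => dslope q 0 a + R * Real.arcsin (a * R / k)
    - 9 / 10 * R * Real.arcsin (9 / 10 * (a * R) / k)
  have hqd : ∀ a, K - (a * R) ^ 2 ≠ 0 → K - 81 / 100 * (a * R) ^ 2 ≠ 0 →
      HasDerivAt q (-(a * R ^ 2) / √(K - (a * R) ^ 2) +
        81 / 100 * (a * R ^ 2) / √(K - 81 / 100 * (a * R) ^ 2)) a := by
    intro a h1 h2
    have d0 : HasDerivAt (fun a : ℝ => (a * R) ^ 2) (2 * (a * R ^ 2)) a := by
      exact (((hasDerivAt_id' a).mul_const R).pow 2).congr_deriv (by push_cast; ring)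
    have d1 := (d0.const_sub K).sqrt h1
    have d2 := ((d0.const_mul (81 / 100)).const_sub K).sqrt h2
    exact (d1.sub d2).congr_deriv (by ring)
  have hqc : Continuous q := by fun_prop
  have hq0 : HasDerivAt q 0 0 := by
    have := hqd 0 (by simpa using hK.ne') (by simpa using hK.ne')
    simpa using this
  have hq00 : q 0 = 0 := by simp [q]
  have hdc : Continuous (dslope q 0) := by
    rw [continuous_iff_continuousAt]
    intro a
    rcases eq_or_ne a 0 with rfl | ha
    · exact continuousAt_dslope_same.mpr hq0.differentiableAt
    · exact (continuousAt_dslope_of_ne ha).mpr hqc.continuousAt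
  have hGc : Continuous G := by
    have := Real.continuous_arcsin
    fun_prop
  have hds : ∀ a, a ≠ 0 → dslope q 0 a = q a / a := by
    intro a ha
    rw [dslope_of_ne _ ha, slope_def_field, hq00]; simp
  have hderiv : ∀ a ∈ Ioo 0 N \ {k / R, k / (9 / 10 * R)},
      HasDerivAt G (sqrtGap K (a * R) / a ^ 2) a := by
    rintro a ⟨⟨ha0, haN⟩, hne⟩
    simp only [mem_insert_iff, mem_singleton_iff, not_or] at hne
    have n1 : a * R ≠ k := fun h => hne.1 (by rw [eq_div_iff hR.ne']; exact h)
    have n2 : 9 / 10 * (a * R) ≠ k := fun h => hne.2 (by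
      rw [eq_div_iff (by positivity)]; linarith)
    have haR : 0 < a * R := by positivity
    have s1 : ∀ y : ℝ, √(1 - (y / k) ^ 2) = √(K - y ^ 2) / k := by
      intro y
      have : 1 - (y / k) ^ 2 = (K - y ^ 2) / k ^ 2 := by rw [← hkk]; field_simp
      rw [this, Real.sqrt_div' _ (sq_nonneg k), Real.sqrt_sq hsK.le]
    have ne : ∀ y : ℝ, 0 < y → y ≠ k → K - y ^ 2 ≠ 0 := by
      intro y hy hyk h
      apply hyk
      have : y ^ 2 = k ^ 2 := by linarith
      exact (pow_left_inj₀ hy.le hsK.le two_ne_zero).mp this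
    have key : ∀ t : ℝ, 0 < t → t * (a * R) ≠ k → HasDerivAt
        (fun a => t * R * Real.arcsin (t * (a * R) / k))
        (t ^ 2 * R ^ 2 / √(K - (t * (a * R)) ^ 2)) a := by
      intro t ht htk
      have h0 : 0 < t * (a * R) := by positivity
      have h1 : t * (a * R) / k ≠ 1 := fun h => htk (by rwa [div_eq_one_iff_eq hsK.ne'] at h)
      have h2 : t * (a * R) / k ≠ -1 := by
        have : 0 < t * (a * R) / k := by positivity
        linarith
      have d := ((Real.hasDerivAt_arcsin h2 h1).comp a
        ((((hasDerivAt_id' a).mul_const R).const_mul t).div_const k)).const_mul (t * R)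
      refine d.congr_deriv ?_
      rw [s1]
      field_simp
    have k1 := key 1 one_pos (by simpa using n1)
    have k2 := key (9 / 10) (by norm_num) n2
    have hY : (9 / 10 * (a * R)) ^ 2 = 81 / 100 * (a * R) ^ 2 := by ring
    have ne2 := ne _ (by positivity) n2
    rw [hY] at ne2 k2
    have dq := (hqd a (ne _ haR n1) ne2).div (hasDerivAt_id' a) ha0.ne'
    have ev : G =ᶠ[nhds a] fun x => q x / x + 1 * R * Real.arcsin (1 * (x * R) / k)
        - 9 / 10 * R * Real.arcsin (9 / 10 * (x * R) / k) := by
      filter_upwards [eventually_ne_nhds ha0.ne'] with x hx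
      simp only [G, hds x hx, one_mul]
    refine HasDerivAt.congr_of_eventuallyEq ?_ ev
    refine ((dq.add k1).sub k2).congr_deriv ?_
    simp only [q, sqrtGap, one_mul, one_pow]
    have hX : (0 : ℝ) ≤ √(K - (a * R) ^ 2) := Real.sqrt_nonneg _
    set X := √(K - (a * R) ^ 2)
    set Y := √(K - 81 / 100 * (a * R) ^ 2)
    have : (-(a * R ^ 2) / X + 81 / 100 * (a * R ^ 2) / Y) * a =
      (-(R ^ 2 / X) + 81 / 100 * R ^ 2 / Y) * a ^ 2 := by ring
    rw [mul_one, this, sub_div, mul_div_assoc, div_self (pow_ne_zero 2 ha0.ne')]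
    ring
  have hgi : IntervalIntegrable (fun a => sqrtGap K (a * R) / a ^ 2) volume 0 N := by
    have h0 : 0 ≤ k / R := by positivity
    refine IntervalIntegrable.trans (b := k / R) (MonotoneOn.intervalIntegrable ?_)
      (AntitoneOn.intervalIntegrable ?_)
    · rw [uIcc_of_le h0]; exact sqrtGap_div_sq_mono hK hR
    · rw [uIcc_of_le hmN]; exact (sqrtGap_div_sq_anti hK hR).mono Icc_subset_Ici_self
  have := integral_eq_of_hasDerivAt_off_countable G (fun a => sqrtGap K (a * R) / a ^ 2)
    (s := {k / R, k / (9 / 10 * R)}) (a := 0) (b := N) (by simp)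
    hGc.continuousOn (by rwa [min_eq_left hN0.le, max_eq_right hN0.le]) hgi
  rw [this]
  have hG0 : G 0 = 0 := by simp [G, dslope_same, hq0.deriv]
  have e1 : 1 ≤ 9 / 10 * (N * R) / k := by
    rw [div_le_iff₀ (by positivity)] at hN
    rw [le_div_iff₀ hsK]; linarith
  have e2 : 1 ≤ N * R / k := by
    refine e1.trans ?_
    have : 0 < N * R := by positivity
    exact div_le_div_of_nonneg_right (by linarith) hsK.le
  have hK1 : K ≤ 81 / 100 * (N * R) ^ 2 := by
    rw [le_div_iff₀ hsK] at e1
    rw [← hkk]; nlinarith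
  have hqN : q N = 0 := by
    simp only [q]
    rw [Real.sqrt_eq_zero_of_nonpos (by linarith), Real.sqrt_eq_zero_of_nonpos
      (by nlinarith [sq_nonneg (N * R)]), sub_zero]
  have hGN : G N = Real.pi / 20 * R := by
    simp only [G]
    rw [hds N hN0.ne', hqN, Real.arcsin_of_one_le e1, Real.arcsin_of_one_le e2]
    ring
  rw [hGN, hG0, sub_zero]

lemma mul_sum_sqrtGap_div_sq_le {K R : ℝ} (hK : 0 < K) (hR : 0 < R) {q : ℕ} (hq : 0 < q)
    {𝒜 : Finset ℤ} (hpos : ∀ a ∈ 𝒜, 0 < a) (hcong : ∀ a ∈ 𝒜, ∀ a' ∈ 𝒜, (q : ℤ) ∣ a - a') :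
    q * ∑ a ∈ 𝒜, sqrtGap K (a * R) / (a : ℝ) ^ 2 ≤
      Real.pi / 20 * R + 2 * q * (R / √(√K / R)) := by
  have hsK := Real.sqrt_pos.mpr hK
  have hpos' : ∀ a ∈ 𝒜, (0 : ℝ) < a := fun a ha => by exact_mod_cast hpos a ha
  have hsum : 0 ≤ ∑ a ∈ 𝒜, (a : ℝ) := Finset.sum_nonneg fun a ha => (hpos' a ha).le
  have hN1 : √K / R ≤ √K / (9 / 10 * R) := by gcongr; linarith
  have hN0 : 0 ≤ √K / R := by positivity
  rw [← integral_sqrtGap_div_sq hK hR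
    (N := √K / (9 / 10 * R) + ∑ a ∈ 𝒜, (a : ℝ)) (by linarith)]
  refine mul_sum_le_integral_of_unimodal
    (g := fun a : ℝ => sqrtGap K (a * R) / a ^ 2) hq (m := √K / R) hN0 (by linarith)
    (fun x => div_nonneg (sqrtGap_nonneg _ _) (sq_nonneg _)) (sqrtGap_div_sq_mono hK hR)
    ((sqrtGap_div_sq_anti hK hR).mono Set.Icc_subset_Ici_self) (fun a ha => ⟨hpos a ha, ?_⟩)
    hcong (by positivity) (fun a ha => ?_)
  · have := Finset.single_le_sum (f := fun a : ℤ => (a : ℝ)) (fun a ha => (hpos' a ha).le) ha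
    linarith
  · refine sqrtGap_div_sq_le hK hR ?_
    exact_mod_cast hpos a ha

lemma continuous_sqrtGap_cube (w : ℝ) : Continuous fun A : ℝ => sqrtGap (4 * A ^ 3) w := by
  unfold sqrtGap; fun_prop

lemma mul_sum_sqrtGap_cube_le {w T : ℝ} (hw : 0 < w) (hT : 0 ≤ T) {q : ℕ} (hq : 0 < q)
    {𝒮 : Finset ℤ} (hmem : ∀ n ∈ 𝒮, 0 < n ∧ (n : ℝ) ≤ T)
    (hcong : ∀ n ∈ 𝒮, ∀ n' ∈ 𝒮, (q : ℤ) ∣ n - n') :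
    q * ∑ n ∈ 𝒮, sqrtGap (4 * (n : ℝ) ^ 3) w ≤
      (∫ A in (0 : ℝ)..T, sqrtGap (4 * A ^ 3) w) + 2 * q * w := by
  obtain ⟨m, hm0, hm⟩ : ∃ m : ℝ, 0 < m ∧ 4 * m ^ 3 = w ^ 2 := by
    refine ⟨(w ^ 2 / 4) ^ ((1 : ℝ) / 3), by positivity, ?_⟩
    rw [← Real.rpow_natCast, ← Real.rpow_mul (by positivity)]
    norm_num
    ring
  refine mul_sum_le_integral_of_unimodal (g := fun A : ℝ => sqrtGap (4 * A ^ 3) w) hq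
    (m := min m T) (le_min hm0.le hT) (min_le_right _ _) (fun x => sqrtGap_nonneg _ _) ?_ ?_
    hmem hcong hw.le (fun n _ => sqrtGap_le _ hw.le)
  · rintro x ⟨hx0, -⟩ y ⟨hy0, hy⟩ hxy
    refine sqrtGap_mono_left (by gcongr) ?_
    rw [← hm]
    have := hy.trans (min_le_left _ _)
    gcongr
  · rintro x ⟨hx, hxT⟩ y ⟨-, hyT⟩ hxy
    rcases le_total m T with h | h
    · rw [min_eq_left h] at hx
      have hx0 : 0 < x := hm0.trans_le hx
      refine sqrtGap_anti_left (by gcongr) (by positivity) ?_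
      rw [← hm]
      gcongr
    · rw [min_eq_right h] at hx
      have : x = y := by linarith
      rw [this]

open MeasureTheory in
lemma mul_sum_integral_sqrtGap_le {R T : ℝ} (hR : 0 < R) (hT : 0 ≤ T) {q : ℕ} (hq : 0 < q)
    {𝒜 : Finset ℤ} (hpos : ∀ a ∈ 𝒜, 0 < a) (hcong : ∀ a ∈ 𝒜, ∀ a' ∈ 𝒜, (q : ℤ) ∣ a - a') :
    q * ∑ a ∈ 𝒜, (∫ A in (0 : ℝ)..T, sqrtGap (4 * A ^ 3) (a * R)) / (a : ℝ) ^ 2 ≤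
      Real.pi / 20 * R * T + 8 * q * R * √R * T ^ (1 / 4 : ℝ) := by
  have i1 : ∀ a ∈ 𝒜, IntervalIntegrable
      (fun A : ℝ => sqrtGap (4 * A ^ 3) (a * R) / (a : ℝ) ^ 2) volume 0 T := fun a _ =>
    ((continuous_sqrtGap_cube _).div_const _).intervalIntegrable _ _
  have i2 : IntervalIntegrable (fun A : ℝ => A ^ (-(3 / 4) : ℝ)) volume 0 T :=
    intervalIntegral.intervalIntegrable_rpow' (by norm_num)
  have e1 : q * ∑ a ∈ 𝒜, (∫ A in (0 : ℝ)..T, sqrtGap (4 * A ^ 3) (a * R)) / (a : ℝ) ^ 2 =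
      ∫ A in (0 : ℝ)..T, q * ∑ a ∈ 𝒜, sqrtGap (4 * A ^ 3) (a * R) / (a : ℝ) ^ 2 := by
    rw [intervalIntegral.integral_const_mul, intervalIntegral.integral_finsetSum i1]
    simp only [intervalIntegral.integral_div]
  have e2 : ∫ A in (0 : ℝ)..T, (Real.pi / 20 * R + 2 * q * (R * √R) * A ^ (-(3 / 4) : ℝ)) =
      Real.pi / 20 * R * T + 8 * q * R * √R * T ^ (1 / 4 : ℝ) := by
    rw [intervalIntegral.integral_add (by simp) (i2.const_mul _),
      intervalIntegral.integral_const, intervalIntegral.integral_const_mul,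
      integral_rpow (Or.inl (by norm_num))]
    norm_num
    ring
  rw [e1, ← e2]
  refine intervalIntegral.integral_mono_on_of_le_Ioo hT ?_ ?_ ?_
  · exact (continuous_const.mul (continuous_finsetSum _ fun a _ =>
      (continuous_sqrtGap_cube _).div_const _)).intervalIntegrable _ _
  · exact (by simp : IntervalIntegrable (fun _ => Real.pi / 20 * R) volume 0 T).add
      (i2.const_mul _)
  · rintro A ⟨hA, -⟩
    refine (mul_sum_sqrtGap_div_sq_le (by positivity) hR hq hpos hcong).trans ?_
    rw [mul_assoc (2 * (q : ℝ))]
    gcongr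
    have h1 : A ^ (3 / 4 : ℝ) ≤ √√(4 * A ^ 3) := by
      have : A ^ (3 / 4 : ℝ) = √√(A ^ 3) := by
        rw [Real.sqrt_eq_rpow, Real.sqrt_eq_rpow, ← Real.rpow_natCast, ← Real.rpow_mul hA.le,
          ← Real.rpow_mul hA.le]
        norm_num
      rw [this]
      gcongr
      have : 0 < A ^ 3 := by positivity
      linarith
    have h2 : 0 < A ^ (3 / 4 : ℝ) := by positivity
    have h3 := Real.sqrt_pos.mpr hR
    rw [Real.sqrt_div' _ hR.le, Real.rpow_neg hA.le, ← div_eq_mul_inv, div_div_eq_mul_div]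
    gcongr

/-- The region of binary cubic forms used to count discriminants with class number
divisible by three. -/
def CubicRegion (M : ℕ) (R : ℝ) (v : ℤ × ℤ × ℤ × ℤ) : Prop :=
  0 < v.1 ∧ 0 ≤ v.2.1 ∧ v.2.1 < v.1 * M ∧ 0 < v.2.1 ^ 2 - v.1 * v.2.2.1 ∧
    3 * ((v.2.1 ^ 2 - v.1 * v.2.2.1 : ℤ) : ℝ) ^ 2 ≤ R ^ 2 ∧
    0 ≤ cubicCov v.1 v.2.1 v.2.2.1 v.2.2.2 ∧
    81 / 100 * R ^ 2 ≤ -((cubicDisc v.1 v.2.1 v.2.2.1 v.2.2.2 : ℤ) : ℝ) ∧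
    -((cubicDisc v.1 v.2.1 v.2.2.1 v.2.2.2 : ℤ) : ℝ) ≤ R ^ 2

lemma card_le_sum_of_slices {α β : Type*} [DecidableEq α] (𝒯 : Finset (α × β)) (F : α → ℝ)
    (h : ∀ x ∈ 𝒯.image Prod.fst, ∀ 𝒰 : Finset β, (∀ y ∈ 𝒰, (x, y) ∈ 𝒯) → (𝒰.card : ℝ) ≤ F x) :
    (𝒯.card : ℝ) ≤ ∑ x ∈ 𝒯.image Prod.fst, F x := by
  classical
  rw [Finset.card_eq_sum_card_image Prod.fst 𝒯, Nat.cast_sum]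
  refine Finset.sum_le_sum fun x hx => ?_
  have e : (𝒯.filter fun v => v.1 = x).card =
      ((𝒯.filter fun v => v.1 = x).image Prod.snd).card := by
    refine (Finset.card_image_of_injOn ?_).symm
    rintro ⟨a, b⟩ hv ⟨a', b'⟩ hv' hb
    have h1 := (Finset.mem_filter.mp (Finset.mem_coe.mp hv)).2
    have h2 := (Finset.mem_filter.mp (Finset.mem_coe.mp hv')).2
    exact Prod.ext (h1.trans h2.symm) hb
  rw [e]
  refine h x hx _ fun y hy => ?_
  obtain ⟨⟨a, b⟩, hv, rfl⟩ := Finset.mem_image.mp hy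
  obtain ⟨h1, rfl⟩ := Finset.mem_filter.mp hv
  exact h1

lemma card_cubicRegion_slice_le {M : ℕ} (hM : 0 < M) {R : ℝ} {a b c : ℤ}
    {𝒟 : Finset ℤ} (hmem : ∀ d ∈ 𝒟, CubicRegion M R (a, b, c, d))
    (hcong : ∀ d ∈ 𝒟, ∀ d' ∈ 𝒟, (M : ℤ) ∣ d - d') :
    (𝒟.card : ℝ) ≤
      sqrtGap (4 * ((b ^ 2 - a * c : ℤ) : ℝ) ^ 3) (a * R) / ((a : ℝ) ^ 2 * M) + 1 := by
  have hM' : (0 : ℝ) < M := by exact_mod_cast hM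
  rcases 𝒟.eq_empty_or_nonempty with rfl | ⟨d₀, hd₀⟩
  · have := sqrtGap_nonneg (4 * ((b ^ 2 - a * c : ℤ) : ℝ) ^ 3) (a * R)
    simp only [Finset.card_empty, Nat.cast_zero]
    positivity
  have ha : 0 < a := (hmem d₀ hd₀).1
  have ha' : (0 : ℝ) < a := by exact_mod_cast ha
  have hgap := sqrtGap_nonneg (4 * ((b ^ 2 - a * c : ℤ) : ℝ) ^ 3) (a * R)
  unfold sqrtGap at hgap ⊢
  set A : ℝ := ((b ^ 2 - a * c : ℤ) : ℝ) with hA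
  set lo := √(4 * A ^ 3 - (a * R) ^ 2)
  set hi := √(4 * A ^ 3 - 81 / 100 * (a * R) ^ 2)
  set e : ℝ := -3 * a * b * c + 2 * b ^ 3 with he
  have := card_le_of_mem_Icc hM (𝒮 := 𝒟) (u := (lo - e) / a ^ 2) (v := (hi - e) / a ^ 2)
    (by gcongr; linarith) hcong ?_
  · refine this.trans (le_of_eq ?_)
    field_simp
    ring
  intro d hd
  obtain ⟨-, -, -, -, -, hD, h1, h2⟩ := hmem d hd
  simp only at hD h1 h2
  have hs : ((cubicCov a b c d : ℤ) : ℝ) ^ 2 - 4 * A ^ 3 =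
      (a : ℝ) ^ 2 * ((cubicDisc a b c d : ℤ) : ℝ) := by
    rw [hA]; exact_mod_cast cubic_syzygy a b c d
  have hD' : (0 : ℝ) ≤ ((cubicCov a b c d : ℤ) : ℝ) := by exact_mod_cast hD
  have hDe : ((cubicCov a b c d : ℤ) : ℝ) = d * a ^ 2 + e := by
    rw [he, cubicCov]; push_cast; ring
  have ha2 : (0 : ℝ) < (a : ℝ) ^ 2 := by positivity
  rw [div_le_iff₀ ha2, le_div_iff₀ ha2]
  constructor
  · have : lo ≤ ((cubicCov a b c d : ℤ) : ℝ) := by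
      refine Real.sqrt_le_iff.mpr ⟨hD', ?_⟩
      nlinarith [mul_le_mul_of_nonneg_left h2 ha2.le]
    linarith
  · have : ((cubicCov a b c d : ℤ) : ℝ) ≤ hi := by
      refine Real.le_sqrt_of_sq_le ?_
      nlinarith [mul_le_mul_of_nonneg_left h1 ha2.le]
    linarith

lemma CubicRegion.le_div_sqrt_three {M : ℕ} {R : ℝ} (hR : 0 < R) {v : ℤ × ℤ × ℤ × ℤ}
    (h : CubicRegion M R v) : ((v.2.1 ^ 2 - v.1 * v.2.2.1 : ℤ) : ℝ) ≤ R / √3 := by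
  obtain ⟨-, -, -, -, h, -⟩ := h
  have h3 : (0 : ℝ) < √3 := by positivity
  rw [le_div_iff₀ h3]
  refine abs_le_of_sq_le_sq' ?_ hR.le |>.2
  rw [mul_pow, Real.sq_sqrt (by norm_num)]
  linarith

lemma card_cubicRegion_slice_two_le {M : ℕ} (hM : 0 < M) {R : ℝ} (hR : 0 < R) {a : ℕ}
    (ha : 0 < a) {b : ℤ} {𝒞 : Finset (ℤ × ℤ)}
    (hmem : ∀ v ∈ 𝒞, CubicRegion M R (a, b, v))
    (hcong : ∀ v ∈ 𝒞, ∀ v' ∈ 𝒞, (M : ℤ) ∣ v.1 - v'.1 ∧ (M : ℤ) ∣ v.2 - v'.2) :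
    (𝒞.card : ℝ) ≤ (∫ A in (0 : ℝ)..(R / √3), sqrtGap (4 * A ^ 3) (a * R)) / ((a : ℝ) ^ 3 * M ^ 2)
      + (2 * R + R / √3) / (a * M) + 1 := by
  classical
  have hM' : (0 : ℝ) < M := by exact_mod_cast hM
  have ha' : (0 : ℝ) < a := by exact_mod_cast ha
  have hT : 0 ≤ R / √3 := by positivity
  set 𝒞₁ := 𝒞.image Prod.fst with h𝒞₁
  set A : ℤ → ℤ := fun c => b ^ 2 - a * c with hA
  have hAinj : Function.Injective A := by
    intro c c' h
    have : (a : ℤ) * c = a * c' := by simp only [hA] at h; linarith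
    exact mul_left_cancel₀ (by exact_mod_cast ha.ne') this
  have hrep : ∀ c ∈ 𝒞₁, ∃ d, (c, d) ∈ 𝒞 := by
    intro c hc
    obtain ⟨⟨c, d⟩, hv, rfl⟩ := Finset.mem_image.mp hc
    exact ⟨d, hv⟩
  have h1 := card_le_sum_of_slices 𝒞
    (fun c => sqrtGap (4 * ((A c : ℤ) : ℝ) ^ 3) (a * R) / ((a : ℝ) ^ 2 * M) + 1) (by
      intro c hc 𝒰 h𝒰
      have := card_cubicRegion_slice_le hM (a := a) (b := b) (c := c) (𝒟 := 𝒰)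
        (fun d hd => hmem _ (h𝒰 d hd)) fun d hd d' hd' => (hcong _ (h𝒰 d hd) _ (h𝒰 d' hd')).2
      exact_mod_cast this)
  have hAmem : ∀ n ∈ 𝒞₁.image A, 0 < n ∧ (n : ℝ) ≤ R / √3 := by
    intro n hn
    obtain ⟨c, hc, rfl⟩ := Finset.mem_image.mp hn
    obtain ⟨d, hd⟩ := hrep c hc
    exact ⟨(hmem _ hd).2.2.2.1, (hmem _ hd).le_div_sqrt_three hR⟩
  have hAcong : ∀ n ∈ 𝒞₁.image A, ∀ n' ∈ 𝒞₁.image A, ((a * M : ℕ) : ℤ) ∣ n - n' := by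
    intro n hn n' hn'
    obtain ⟨c, hc, rfl⟩ := Finset.mem_image.mp hn
    obtain ⟨c', hc', rfl⟩ := Finset.mem_image.mp hn'
    obtain ⟨d, hd⟩ := hrep c hc
    obtain ⟨d', hd'⟩ := hrep c' hc'
    obtain ⟨k, hk⟩ := (hcong _ hd _ hd').1
    refine ⟨-k, ?_⟩
    simp only at hk
    simp only [hA]
    push_cast
    linear_combination (-(a : ℤ)) * hk
  have haM : 0 < a * M := Nat.mul_pos ha hM
  have h2 := mul_sum_sqrtGap_cube_le (w := a * R) (by positivity) hT haM hAmem hAcong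
  have h3 := card_le_of_mem_Icc haM hT hAcong fun n hn =>
    ⟨by exact_mod_cast (hAmem n hn).1.le, (hAmem n hn).2⟩
  rw [Finset.card_image_of_injective _ hAinj] at h3
  rw [Finset.sum_image fun x _ y _ h => hAinj h] at h2
  rw [Finset.sum_add_distrib, ← Finset.sum_div, Finset.sum_const, nsmul_eq_mul, mul_one] at h1
  refine h1.trans ?_
  push_cast at h2 h3
  set s := ∑ c ∈ 𝒞₁, sqrtGap (4 * ((A c : ℤ) : ℝ) ^ 3) (a * R)
  set I := ∫ A in (0 : ℝ)..(R / √3), sqrtGap (4 * A ^ 3) (a * R)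
  have h4 : s / ((a : ℝ) ^ 2 * M) ≤ I / ((a : ℝ) ^ 3 * M ^ 2) + 2 * R / (a * M) := by
    have e1 : s / ((a : ℝ) ^ 2 * M) = a * M * s / ((a : ℝ) ^ 3 * M ^ 2) := by field_simp
    have e2 : I / ((a : ℝ) ^ 3 * M ^ 2) + 2 * R / (a * M) =
        (I + 2 * (a * M) * (a * R)) / ((a : ℝ) ^ 3 * M ^ 2) := by field_simp
    rw [e1, e2]
    gcongr
  have h5 : (2 * R + R / √3) / (a * M) = 2 * R / (a * M) + R / √3 / (a * M) := add_div _ _ _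
  rw [h5]
  rw [sub_zero] at h3
  linarith

lemma card_cubicRegion_slice_three_le {M : ℕ} (hM : 0 < M) {R : ℝ} (hR : 0 < R) {a : ℕ}
    (ha : 0 < a) {ℬ : Finset (ℤ × ℤ × ℤ)} (hmem : ∀ v ∈ ℬ, CubicRegion M R (a, v))
    (hcong : ∀ v ∈ ℬ, ∀ v' ∈ ℬ, (M : ℤ) ∣ v.1 - v'.1 ∧ (M : ℤ) ∣ v.2.1 - v'.2.1 ∧
      (M : ℤ) ∣ v.2.2 - v'.2.2) :
    (ℬ.card : ℝ) ≤ (∫ A in (0 : ℝ)..(R / √3), sqrtGap (4 * A ^ 3) (a * R)) / (a : ℝ) ^ 2 / M ^ 2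
      + (2 * R + R / √3 + a) := by
  classical
  have hM' : (0 : ℝ) < M := by exact_mod_cast hM
  have hM1 : (1 : ℝ) ≤ M := by exact_mod_cast hM
  have ha' : (0 : ℝ) < a := by exact_mod_cast ha
  set I := ∫ A in (0 : ℝ)..(R / √3), sqrtGap (4 * A ^ 3) (a * R)
  have hI : 0 ≤ I := intervalIntegral.integral_nonneg (by positivity) fun A _ => sqrtGap_nonneg _ _
  set C := I / ((a : ℝ) ^ 3 * M ^ 2) + (2 * R + R / √3) / (a * M) + 1 with hC
  have hC0 : 0 ≤ C := by positivity
  have h1 := card_le_sum_of_slices ℬ (fun _ => C) (by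
      intro b hb 𝒰 h𝒰
      exact card_cubicRegion_slice_two_le hM hR ha (b := b) (𝒞 := 𝒰)
        (fun v hv => hmem _ (h𝒰 v hv)) fun v hv v' hv' => (hcong _ (h𝒰 v hv) _ (h𝒰 v' hv')).2)
  rw [Finset.sum_const, nsmul_eq_mul] at h1
  have hb : (((ℬ.image Prod.fst).card : ℕ) : ℝ) ≤ a := by
    have hrep : ∀ b ∈ ℬ.image Prod.fst, ∃ v, (b, v) ∈ ℬ := by
      intro c hc
      obtain ⟨⟨c, d⟩, hv, rfl⟩ := Finset.mem_image.mp hc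
      exact ⟨d, hv⟩
    have h1a : (1 : ℝ) ≤ a := by exact_mod_cast ha
    have := card_le_of_mem_Icc hM (𝒮 := ℬ.image Prod.fst) (u := 0) (v := a * M - 1)
      (by nlinarith) ?_ ?_
    · have h2 : ((a : ℝ) * M - 1 - 0) / M < a := by
        rw [div_lt_iff₀ hM']; linarith
      have h3 : (((ℬ.image Prod.fst).card : ℕ) : ℝ) < a + 1 := by linarith
      have h4 : (ℬ.image Prod.fst).card < a + 1 := by exact_mod_cast h3
      exact_mod_cast Nat.lt_succ_iff.mp h4
    · intro b hb b' hb'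
      obtain ⟨v, hv⟩ := hrep b hb
      obtain ⟨v', hv'⟩ := hrep b' hb'
      exact (hcong _ hv _ hv').1
    · intro b hb
      obtain ⟨v, hv⟩ := hrep b hb
      obtain ⟨-, h1, h2, -⟩ := hmem _ hv
      simp only at h1 h2
      have h3 : b + 1 ≤ a * M := h2
      have h4 : (b : ℝ) + 1 ≤ a * M := by exact_mod_cast h3
      exact ⟨by exact_mod_cast h1, by linarith⟩
  calc (ℬ.card : ℝ) ≤ a * C := h1.trans (mul_le_mul_of_nonneg_right hb hC0)
    _ = I / (a : ℝ) ^ 2 / M ^ 2 + ((2 * R + R / √3) / M + a) := by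
      rw [hC]; field_simp; ring
    _ ≤ _ := by
      gcongr
      exact div_le_self (by positivity) hM1

lemma CubicRegion.sq_fst_le {M : ℕ} {R : ℝ} (hR : 0 < R) {v : ℤ × ℤ × ℤ × ℤ}
    (h : CubicRegion M R v) : (v.1 : ℝ) ^ 2 ≤ R := by
  obtain ⟨a, b, c, d⟩ := v
  have hA := h.le_div_sqrt_three hR
  obtain ⟨ha, -, -, hA0, hA2, -, h1, -⟩ := h
  simp only at ha hA0 hA2 h1 hA ⊢
  have hs : ((cubicCov a b c d : ℤ) : ℝ) ^ 2 - 4 * ((b ^ 2 - a * c : ℤ) : ℝ) ^ 3 =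
      (a : ℝ) ^ 2 * ((cubicDisc a b c d : ℤ) : ℝ) := by
    exact_mod_cast cubic_syzygy a b c d
  have hA0' : (0 : ℝ) < ((b ^ 2 - a * c : ℤ) : ℝ) := by exact_mod_cast hA0
  set A : ℝ := ((b ^ 2 - a * c : ℤ) : ℝ)
  have h3 : (1.73 : ℝ) ≤ √3 := Real.le_sqrt_of_sq_le (by norm_num)
  have hA' : A ≤ 100 / 173 * R := by
    refine hA.trans ?_
    rw [div_le_iff₀ (by positivity)]
    nlinarith
  have e1 : (a : ℝ) ^ 2 * (81 / 100 * R ^ 2) ≤ 4 * A ^ 3 := by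
    nlinarith [mul_le_mul_of_nonneg_left h1 (sq_nonneg (a : ℝ)),
      sq_nonneg ((cubicCov a b c d : ℤ) : ℝ)]
  have e2 : 4 * A ^ 3 ≤ 81 / 100 * R ^ 2 * R := by
    have : A ^ 3 ≤ A * (R ^ 2 / 3) := by nlinarith
    have : A * (R ^ 2 / 3) ≤ 100 / 173 * R * (R ^ 2 / 3) := by gcongr
    nlinarith [pow_pos hR 3]
  have e3 : (0 : ℝ) < 81 / 100 * R ^ 2 := by positivity
  exact le_of_mul_le_mul_right (by linarith) e3

/-- The number of forms of the region in one residue class. -/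
lemma card_cubicRegion_le {M : ℕ} (hM : 0 < M) {R : ℝ} (hR : 1 ≤ R)
    {𝒯 : Finset (ℤ × ℤ × ℤ × ℤ)} (hmem : ∀ v ∈ 𝒯, CubicRegion M R v)
    (hcong : ∀ v ∈ 𝒯, ∀ v' ∈ 𝒯, (M : ℤ) ∣ v.1 - v'.1 ∧ (M : ℤ) ∣ v.2.1 - v'.2.1 ∧
      (M : ℤ) ∣ v.2.2.1 - v'.2.2.1 ∧ (M : ℤ) ∣ v.2.2.2 - v'.2.2.2) :
    (𝒯.card : ℝ) ≤ Real.pi / (20 * √3) * R ^ 2 / M ^ 3 + 12 * (R * √R * R ^ (1 / 4 : ℝ)) := by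
  classical
  have hR0 : 0 < R := by linarith
  have hM' : (0 : ℝ) < M := by exact_mod_cast hM
  have hM1 : (1 : ℝ) ≤ M := by exact_mod_cast hM
  set T := R / √3 with hT
  have hT0 : 0 ≤ T := by positivity
  have hTR : T ≤ R := div_le_self hR0.le (by
    rw [Real.one_le_sqrt]; norm_num)
  set 𝒜 := 𝒯.image Prod.fst with h𝒜
  have hrep : ∀ a ∈ 𝒜, ∃ v, (a, v) ∈ 𝒯 := by
    intro a ha
    obtain ⟨⟨a, v⟩, hv, rfl⟩ := Finset.mem_image.mp ha
    exact ⟨v, hv⟩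
  have hpos : ∀ a ∈ 𝒜, 0 < a := fun a ha => by
    obtain ⟨v, hv⟩ := hrep a ha
    exact (hmem _ hv).1
  have hAcong : ∀ a ∈ 𝒜, ∀ a' ∈ 𝒜, (M : ℤ) ∣ a - a' := fun a ha a' ha' => by
    obtain ⟨v, hv⟩ := hrep a ha
    obtain ⟨v', hv'⟩ := hrep a' ha'
    exact (hcong _ hv _ hv').1
  have hle : ∀ a ∈ 𝒜, (a : ℝ) ≤ √R := fun a ha => by
    obtain ⟨v, hv⟩ := hrep a ha
    exact Real.le_sqrt_of_sq_le ((hmem _ hv).sq_fst_le hR0)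
  set I : ℤ → ℝ := fun a => ∫ A in (0 : ℝ)..T, sqrtGap (4 * A ^ 3) (a * R) with hI
  have h1 := card_le_sum_of_slices 𝒯
    (fun a => I a / (a : ℝ) ^ 2 / M ^ 2 + (2 * R + T + a)) (by
      intro a ha 𝒰 h𝒰
      obtain ⟨k, rfl⟩ := Int.eq_ofNat_of_zero_le (hpos a ha).le
      have := card_cubicRegion_slice_three_le hM hR0 (a := k) (by exact_mod_cast hpos _ ha)
        (ℬ := 𝒰) (fun v hv => hmem _ (h𝒰 v hv))
        fun v hv v' hv' => (hcong _ (h𝒰 v hv) _ (h𝒰 v' hv')).2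
      simpa [hI] using this)
  rw [Finset.sum_add_distrib, ← Finset.sum_div] at h1
  have hs1 : 1 ≤ √R := Real.one_le_sqrt.mpr hR
  have hq1 : 1 ≤ R ^ (1 / 4 : ℝ) := Real.one_le_rpow hR (by norm_num)
  have hcard : (𝒜.card : ℝ) ≤ √R := by
    have := card_le_of_mem_Icc (q := 1) one_pos (𝒮 := 𝒜) (u := 1) (v := √R) hs1 (by simp)
      fun a ha => ⟨by exact_mod_cast hpos a ha, hle a ha⟩
    simp at this
    linarith
  have h2 : ∑ a ∈ 𝒜, (2 * R + T + (a : ℝ)) ≤ 4 * (R * √R * R ^ (1 / 4 : ℝ)) := by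
    have hsR : √R ≤ R := by
      rw [Real.sqrt_le_left hR0.le]; nlinarith
    calc ∑ a ∈ 𝒜, (2 * R + T + (a : ℝ)) ≤ ∑ a ∈ 𝒜, 4 * R := by
          refine Finset.sum_le_sum fun a ha => ?_
          linarith [hle a ha]
      _ = 𝒜.card * (4 * R) := by rw [Finset.sum_const, nsmul_eq_mul]
      _ ≤ √R * (4 * R) := by gcongr
      _ = 4 * (R * √R * 1) := by ring
      _ ≤ _ := by gcongr
  have h3 := mul_sum_integral_sqrtGap_le hR0 hT0 hM hpos hAcong
  have h4 : ∑ a ∈ 𝒜, I a / (a : ℝ) ^ 2 ≤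
      (Real.pi / 20 * R * T + 8 * M * R * √R * T ^ (1 / 4 : ℝ)) / M := by
    rw [le_div_iff₀ hM', mul_comm]
    exact h3
  have h5 : (∑ a ∈ 𝒜, I a / (a : ℝ) ^ 2) / M ^ 2 ≤
      Real.pi / (20 * √3) * R ^ 2 / M ^ 3 + 8 * (R * √R * R ^ (1 / 4 : ℝ)) := by
    calc (∑ a ∈ 𝒜, I a / (a : ℝ) ^ 2) / M ^ 2
        ≤ (Real.pi / 20 * R * T + 8 * M * R * √R * T ^ (1 / 4 : ℝ)) / M / M ^ 2 := by gcongr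
      _ = Real.pi / (20 * √3) * R ^ 2 / M ^ 3 + 8 * (R * √R * T ^ (1 / 4 : ℝ)) / M ^ 2 := by
        rw [hT]; field_simp
      _ ≤ Real.pi / (20 * √3) * R ^ 2 / M ^ 3 + 8 * (R * √R * T ^ (1 / 4 : ℝ)) := by
        gcongr
        exact div_le_self (by positivity) (one_le_pow₀ hM1)
      _ ≤ _ := by gcongr
  linarith

lemma cubic_translate_invariants {R : Type*} [CommRing R] (a b c d n : R) :
    let b' := b + n * a
    let c' := c + 2 * n * b + n ^ 2 * a
    let d' := d + 3 * n * c + 3 * n ^ 2 * b + n ^ 3 * a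
    cubicDisc a b' c' d' = cubicDisc a b c d ∧ b' ^ 2 - a * c' = b ^ 2 - a * c ∧
      cubicCov a b' c' d' = cubicCov a b c d := by
  refine ⟨?_, by ring, ?_⟩
  · simp only [cubicDisc]; ring
  · simp only [cubicCov]; ring

lemma exists_normalized_cubic {Δ a b c d : ℤ} (ha : a ≠ 0) (hΔ : cubicDisc a b c d = Δ) :
    ∃ a' b' c' d' : ℤ, 0 < a' ∧ 0 ≤ b' ∧ b' < a' ∧ cubicDisc a' b' c' d' = Δ ∧
      b' ^ 2 - a' * c' = b ^ 2 - a * c ∧ 0 ≤ cubicCov a' b' c' d' := by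
  have step1 : ∃ a' b' c' d' : ℤ, 0 < a' ∧ cubicDisc a' b' c' d' = Δ ∧
      b' ^ 2 - a' * c' = b ^ 2 - a * c := by
    rcases lt_or_gt_of_ne ha with h | h
    · refine ⟨-a, -b, -c, -d, by omega, ?_, by ring⟩
      rw [← hΔ]; unfold cubicDisc; ring
    · exact ⟨a, b, c, d, h, hΔ, rfl⟩
  obtain ⟨a, b₁, c₁, d₁, ha, h1, h2⟩ := step1
  have step2 : ∃ b' c' d' : ℤ, cubicDisc a b' c' d' = Δ ∧
      b' ^ 2 - a * c' = b₁ ^ 2 - a * c₁ ∧ 0 ≤ cubicCov a b' c' d' := by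
    rcases le_total 0 (cubicCov a b₁ c₁ d₁) with h | h
    · exact ⟨b₁, c₁, d₁, h1, rfl, h⟩
    · refine ⟨-b₁, c₁, -d₁, ?_, by ring, ?_⟩
      · rw [← h1]; unfold cubicDisc; ring
      · have : cubicCov a (-b₁) c₁ (-d₁) = -cubicCov a b₁ c₁ d₁ := by unfold cubicCov; ring
        omega
  obtain ⟨b₂, c₂, d₂, h3, h4, h5⟩ := step2
  obtain ⟨e1, e2, e3⟩ := cubic_translate_invariants a b₂ c₂ d₂ (-(b₂ / a))
  have hb : b₂ + -(b₂ / a) * a = b₂ % a := by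
    have := Int.emod_add_mul_ediv b₂ a
    linarith
  refine ⟨a, _, _, _, ha, ?_, ?_, e1.trans h3, e2.trans (h4.trans h2), e3.symm ▸ h5⟩
  · rw [hb]; exact Int.emod_nonneg _ ha.ne'
  · rw [hb]; exact Int.emod_lt_of_pos _ ha

lemma mul_card_le_localCount_mul {M : ℕ} [NeZero M] {δ : ℤ} {R : ℝ} (hR : 1 ≤ R) {ℬ : Finset ℤ}
    (hℬ : ∀ Δ ∈ ℬ, Δ < 0 ∧ Δ % 4 = 1 ∧ Squarefree Δ ∧ 3 ∣ classNum Δ ∧ Δ ≡ δ [ZMOD M] ∧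
      81 / 100 * R ^ 2 ≤ -(Δ : ℝ) ∧ -(Δ : ℝ) ≤ R ^ 2) :
    (M : ℝ) * ℬ.card ≤ localCount M (δ : ZMod M) *
      (Real.pi / (20 * √3) * R ^ 2 / M ^ 3 + 12 * (R * √R * R ^ (1 / 4 : ℝ))) := by
  classical
  have hM : 0 < M := Nat.pos_of_ne_zero (NeZero.ne M)
  have hex : ∀ Δ : ℤ, ∃ v : ℤ × ℤ × ℤ × ℤ, Δ ∈ ℬ → 0 < v.1 ∧ 0 ≤ v.2.1 ∧ v.2.1 < v.1 ∧
      cubicDisc v.1 v.2.1 v.2.2.1 v.2.2.2 = Δ ∧ 0 < v.2.1 ^ 2 - v.1 * v.2.2.1 ∧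
      3 * (v.2.1 ^ 2 - v.1 * v.2.2.1) ^ 2 ≤ -Δ ∧ 0 ≤ cubicCov v.1 v.2.1 v.2.2.1 v.2.2.2 := by
    intro Δ
    by_cases h : Δ ∈ ℬ
    · obtain ⟨h1, h2, h3, h4, -⟩ := hℬ Δ h
      obtain ⟨a, b, c, d, ha, hd, hA, hA2⟩ :=
        exists_cubicDisc_eq_of_three_dvd_classNum h1 h2 h3 h4
      obtain ⟨a', b', c', d', g1, g2, g3, g4, g5, g6⟩ := exists_normalized_cubic ha hd
      exact ⟨(a', b', c', d'), fun _ => ⟨g1, g2, g3, g4, g5.symm ▸ hA, g5.symm ▸ hA2, g6⟩⟩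
    · exact ⟨0, fun h' => absurd h' h⟩
  choose v hv using hex
  let t : ℤ × ℕ → ℤ × ℤ × ℤ × ℤ := fun w =>
    ((v w.1).1, (v w.1).2.1 + w.2 * (v w.1).1,
      (v w.1).2.2.1 + 2 * w.2 * (v w.1).2.1 + (w.2 : ℤ) ^ 2 * (v w.1).1,
      (v w.1).2.2.2 + 3 * w.2 * (v w.1).2.2.1 + 3 * (w.2 : ℤ) ^ 2 * (v w.1).2.1 +
        (w.2 : ℤ) ^ 3 * (v w.1).1)
  have ht : ∀ w ∈ ℬ ×ˢ Finset.range M, CubicRegion M R (t w) ∧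
      cubicDisc (t w).1 (t w).2.1 (t w).2.2.1 (t w).2.2.2 = w.1 := by
    rintro ⟨Δ, n⟩ hw
    obtain ⟨hΔ, hn⟩ := Finset.mem_product.mp hw
    have hn' : n + 1 ≤ M := Finset.mem_range.mp hn
    have hn'' : (n : ℤ) + 1 ≤ M := by exact_mod_cast hn'
    obtain ⟨g1, g2, g3, g4, g5, g6, g7⟩ := hv Δ hΔ
    obtain ⟨-, -, -, -, -, k1, k2⟩ := hℬ Δ hΔ
    obtain ⟨e1, e2, e3⟩ := cubic_translate_invariants (v Δ).1 (v Δ).2.1 (v Δ).2.2.1 (v Δ).2.2.2 n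
    refine ⟨⟨g1, ?_, ?_, ?_, ?_, ?_, ?_, ?_⟩, ?_⟩
    · change 0 ≤ (v Δ).2.1 + n * (v Δ).1
      positivity
    · change (v Δ).2.1 + n * (v Δ).1 < (v Δ).1 * M
      nlinarith
    · exact e2.symm ▸ g5
    · have : 3 * ((((v Δ).2.1 ^ 2 - (v Δ).1 * (v Δ).2.2.1 : ℤ)) : ℝ) ^ 2 ≤ -(Δ : ℝ) := by
        exact_mod_cast g6
      exact e2.symm ▸ this.trans k2
    · exact e3.symm ▸ g7
    · exact (e1.trans g4).symm ▸ k1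
    · exact (e1.trans g4).symm ▸ k2
    · exact e1.trans g4
  have htinj : Set.InjOn t (ℬ ×ˢ Finset.range M : Finset (ℤ × ℕ)) := by
    rintro ⟨Δ, n⟩ hw ⟨Δ', n'⟩ hw' h
    have hw := Finset.mem_coe.mp hw
    have hw' := Finset.mem_coe.mp hw'
    have hΔ : Δ = Δ' := by
      have h1 := (ht _ hw).2
      have h2 := (ht _ hw').2
      rw [h] at h1
      exact h1.symm.trans h2
    subst hΔ
    have ha := (hv Δ (Finset.mem_product.mp hw).1).1
    simp only [t, Prod.mk.injEq] at h
    have h2 : (n : ℤ) * (v Δ).1 = n' * (v Δ).1 := by linarith [h.2.1]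
    have h3 := mul_right_cancel₀ ha.ne' h2
    rw [Nat.cast_inj.mp h3]
  set 𝒯 := (ℬ ×ˢ Finset.range M).image t
  have hcard : 𝒯.card = M * ℬ.card := by
    rw [Finset.card_image_of_injOn htinj, Finset.card_product, Finset.card_range, mul_comm]
  have hmem : ∀ u ∈ 𝒯, CubicRegion M R u ∧
      cubicDisc u.1 u.2.1 u.2.2.1 u.2.2.2 ≡ δ [ZMOD M] := by
    intro u hu
    obtain ⟨w, hw, rfl⟩ := Finset.mem_image.mp hu
    refine ⟨(ht w hw).1, ?_⟩
    rw [(ht w hw).2]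
    exact (hℬ _ (Finset.mem_product.mp hw).1).2.2.2.2.1
  let red : ℤ × ℤ × ℤ × ℤ → ZMod M × ZMod M × ZMod M × ZMod M := fun u =>
    (u.1, u.2.1, u.2.2.1, u.2.2.2)
  set 𝒩 := Finset.univ.filter fun u : ZMod M × ZMod M × ZMod M × ZMod M =>
    cubicDisc u.1 u.2.1 u.2.2.1 u.2.2.2 = (δ : ZMod M) with h𝒩
  have hred : ∀ u ∈ 𝒯, red u ∈ 𝒩 := by
    intro u hu
    refine Finset.mem_filter.mpr ⟨Finset.mem_univ _, ?_⟩
    rw [← (ZMod.intCast_eq_intCast_iff _ _ _).mpr (hmem u hu).2]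
    exact (cubicDisc_map (Int.castRingHom (ZMod M)) _ _ _ _).symm
  have hsum := Finset.card_eq_sum_card_fiberwise hred
  rw [hcard] at hsum
  have hsum' : (M : ℝ) * ℬ.card = ∑ F ∈ 𝒩, ((𝒯.filter fun u => red u = F).card : ℝ) := by
    exact_mod_cast hsum
  rw [hsum', show (localCount M (δ : ZMod M) : ℝ) = (𝒩.card : ℝ) from rfl, ← nsmul_eq_mul]
  refine Finset.sum_le_card_nsmul _ _ _ fun F _ => ?_
  refine card_cubicRegion_le hM hR (fun u hu => (hmem u (Finset.mem_filter.mp hu).1).1) ?_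
  intro u hu u' hu'
  have h := (Finset.mem_filter.mp hu).2.trans (Finset.mem_filter.mp hu').2.symm
  simp only [red, Prod.mk.injEq, ZMod.intCast_eq_intCast_iff] at h
  exact ⟨h.1.symm.dvd, h.2.1.symm.dvd, h.2.2.1.symm.dvd, h.2.2.2.symm.dvd⟩

lemma sum_inv_odd_sq_le (J : ℕ) :
    ∑ j ∈ Finset.range J, 1 / (2 * (j : ℝ) + 3) ^ 2 ≤ 1 / 4 := by
  have h : ∑ j ∈ Finset.range J, 1 / (2 * (j : ℝ) + 3) ^ 2 ≤ 1 / 4 - 1 / (4 * ((J : ℝ) + 1)) := by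
    induction J with
    | zero => simp
    | succ J ih =>
      rw [Finset.sum_range_succ]
      have : 1 / (2 * (J : ℝ) + 3) ^ 2 ≤ 1 / (4 * ((J : ℝ) + 1)) - 1 / (4 * ((J : ℝ) + 2)) := by
        rw [div_sub_div _ _ (by positivity) (by positivity),
          div_le_div_iff₀ (by positivity) (by positivity)]
        nlinarith [(Nat.cast_nonneg J : (0 : ℝ) ≤ J)]
      push_cast
      rw [show (J : ℝ) + 1 + 1 = J + 2 by ring]
      linarith
  have : 0 ≤ 1 / (4 * ((J : ℝ) + 1)) := by positivity
  linarith

/-- Lower bound for the number of squarefree integers of an arithmetic progression in a window. -/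
lemma exists_squarefree_finset {M : ℕ} (hM : 0 < M) (hM2 : 2 ∣ M) {δ : ℤ}
    (hδ : ∀ Δ : ℤ, Δ ≡ δ [ZMOD M] → ∀ q : ℕ, q.Prime → q ∣ M → ¬ (q : ℤ) ^ 2 ∣ Δ)
    {R : ℝ} (hR : 1 ≤ R) :
    ∃ 𝒢 : Finset ℤ, (∀ Δ ∈ 𝒢, Squarefree Δ ∧ Δ ≡ δ [ZMOD M] ∧ 81 / 100 * R ^ 2 ≤ -(Δ : ℝ) ∧
      -(Δ : ℝ) < R ^ 2) ∧ 57 / 400 * R ^ 2 / M - 2 - R ≤ 𝒢.card := by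
  classical
  have hM' : (0 : ℝ) < M := by exact_mod_cast hM
  have hM1 : (1 : ℝ) ≤ M := by exact_mod_cast hM
  set P := (Finset.Ioc ⌊-R ^ 2⌋ ⌊-(81 / 100 * R ^ 2)⌋).filter fun Δ => Δ ≡ δ [ZMOD M] with hP
  have hPmem : ∀ Δ ∈ P, Δ ≡ δ [ZMOD M] ∧ 81 / 100 * R ^ 2 ≤ -(Δ : ℝ) ∧ -(Δ : ℝ) < R ^ 2 := by
    intro Δ hΔ
    obtain ⟨h1, h2⟩ := Finset.mem_filter.mp hΔ
    obtain ⟨h3, h4⟩ := Finset.mem_Ioc.mp h1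
    have h5 := Int.floor_lt.mp h3
    have h6 := Int.le_floor.mp h4
    exact ⟨h2, by linarith, by linarith⟩
  have hPcard : 19 / 100 * R ^ 2 / M - 2 ≤ (P.card : ℝ) := by
    have h := Int.Ioc_filter_modEq_card ⌊-R ^ 2⌋ ⌊-(81 / 100 * R ^ 2)⌋
      (r := (M : ℤ)) (by exact_mod_cast hM) δ
    rw [← hP] at h
    have h1 : (P.card : ℤ) ≥ ⌊((⌊-(81 / 100 * R ^ 2)⌋ - δ : ℤ) : ℚ) / ((M : ℤ) : ℚ)⌋ -
        ⌊((⌊-R ^ 2⌋ - δ : ℤ) : ℚ) / ((M : ℤ) : ℚ)⌋ := by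
      rw [h]; push_cast; exact le_max_left _ _
    set u := ⌊-(81 / 100 * R ^ 2)⌋
    set w := ⌊-R ^ 2⌋
    have h2 := Int.lt_floor_add_one (((u - δ : ℤ) : ℚ) / ((M : ℤ) : ℚ))
    have h3 := Int.floor_le (((w - δ : ℤ) : ℚ) / ((M : ℤ) : ℚ))
    have h4 : (P.card : ℚ) ≥
        ((u - δ : ℤ) : ℚ) / ((M : ℤ) : ℚ) - ((w - δ : ℤ) : ℚ) / ((M : ℤ) : ℚ) - 1 := by
      have : (P.card : ℚ) ≥ (⌊((u - δ : ℤ) : ℚ) / ((M : ℤ) : ℚ)⌋ : ℚ) -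
        (⌊((w - δ : ℤ) : ℚ) / ((M : ℤ) : ℚ)⌋ : ℚ) := by exact_mod_cast h1
      linarith
    rw [← sub_div] at h4
    have h5 : (P.card : ℝ) ≥ ((u : ℝ) - w) / M - 1 := by
      have : ((u - δ : ℤ) : ℚ) - ((w - δ : ℤ) : ℚ) = (u : ℚ) - w := by push_cast; ring
      rw [this] at h4
      exact_mod_cast h4
    have h6 : -(81 / 100 * R ^ 2) < (u : ℝ) + 1 := Int.lt_floor_add_one _
    have h7 : (w : ℝ) ≤ -R ^ 2 := Int.floor_le _
    have h8 : (19 / 100 * R ^ 2 - 1) / M ≤ ((u : ℝ) - w) / M :=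
      div_le_div_of_nonneg_right (by linarith) hM'.le
    rw [sub_div] at h8
    have h9 : 1 / (M : ℝ) ≤ 1 := by rw [div_le_one hM']; exact hM1
    linarith
  set 𝒢 := P.filter Squarefree
  set J := ⌊R⌋₊
  let Q : ℕ → Finset ℤ := fun j =>
    P.filter fun Δ => ((2 * j + 3 : ℕ) : ℤ) ^ 2 ∣ Δ ∧ M.Coprime (2 * j + 3)
  have hcover : (P.filter fun Δ => ¬ Squarefree Δ) ⊆ (Finset.range J).biUnion Q := by
    intro Δ hΔ
    obtain ⟨hΔP, hns⟩ := Finset.mem_filter.mp hΔ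
    obtain ⟨h1, h2, h3⟩ := hPmem Δ hΔP
    have hΔ0 : Δ ≠ 0 := by
      rintro rfl
      simp at h2
      nlinarith
    rw [← Int.squarefree_natAbs, Nat.squarefree_iff_prime_squarefree] at hns
    push Not at hns
    obtain ⟨p, hp, hpd⟩ := hns
    have hpd' : (p : ℤ) ^ 2 ∣ Δ := by
      rw [pow_two, ← Int.dvd_natAbs]; exact_mod_cast hpd
    have hpM : ¬ p ∣ M := fun h => hδ Δ h1 p hp h hpd'
    have hp2 : p ≠ 2 := fun h => hpM (h ▸ hM2)
    have hodd := hp.eq_two_or_odd'.resolve_left hp2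
    obtain ⟨k, hk⟩ := hodd
    have hk1 : 1 ≤ k := by
      have := hp.two_le
      omega
    have hpe : p = 2 * (k - 1) + 3 := by omega
    refine Finset.mem_biUnion.mpr ⟨k - 1, ?_, Finset.mem_filter.mpr ⟨hΔP, ?_, ?_⟩⟩
    · have hple : p ^ 2 ≤ Δ.natAbs :=
        Nat.le_of_dvd (Int.natAbs_pos.mpr hΔ0) (by rw [pow_two]; exact hpd)
      have h4 : ((p : ℝ)) ^ 2 ≤ -(Δ : ℝ) := by
        have h5 : ((Δ.natAbs : ℕ) : ℝ) = -(Δ : ℝ) := by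
          rw [Nat.cast_natAbs, Int.cast_abs, abs_of_neg]
          nlinarith
        rw [← h5]
        exact_mod_cast hple
      have h5 : (p : ℝ) ≤ R := abs_le_of_sq_le_sq' (by linarith) (by linarith) |>.2
      have h6 : p ≤ J := Nat.le_floor h5
      rw [Finset.mem_range]
      omega
    · rw [← hpe]; exact hpd'
    · rw [← hpe]; exact ((Nat.Prime.coprime_iff_not_dvd hp).mpr hpM).symm
  have hQ : ∀ j ∈ Finset.range J,
      ((Q j).card : ℝ) ≤ 19 / 100 * R ^ 2 / M * (1 / (2 * (j : ℝ) + 3) ^ 2) + 1 := by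
    intro j _
    by_cases hc : M.Coprime (2 * j + 3)
    · have hq : 0 < M * (2 * j + 3) ^ 2 := by positivity
      have := card_le_of_mem_Icc hq (𝒮 := Q j) (u := -R ^ 2) (v := -(81 / 100 * R ^ 2))
        (by nlinarith) ?_ ?_
      · refine this.trans (le_of_eq ?_)
        push_cast
        field_simp
        ring
      · intro Δ hΔ Δ' hΔ'
        obtain ⟨h1, h2, -⟩ := Finset.mem_filter.mp hΔ
        obtain ⟨h1', h2', -⟩ := Finset.mem_filter.mp hΔ'
        have h3 : (M : ℤ) ∣ Δ - Δ' := ((hPmem Δ' h1').1.trans (hPmem Δ h1).1.symm).dvd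
        have h4 : ((2 * j + 3 : ℕ) : ℤ) ^ 2 ∣ Δ - Δ' := dvd_sub h2 h2'
        push_cast at h4 ⊢
        refine IsCoprime.mul_dvd ?_ h3 h4
        have := (Nat.isCoprime_iff_coprime.mpr hc).pow_right (n := 2)
        exact_mod_cast this
      · intro Δ hΔ
        obtain ⟨-, h2, h3⟩ := hPmem Δ (Finset.mem_filter.mp hΔ).1
        constructor <;> linarith
    · have : Q j = ∅ := Finset.filter_eq_empty_iff.mpr fun Δ _ h => hc h.2
      rw [this, Finset.card_empty, Nat.cast_zero]
      positivity
  refine ⟨𝒢, fun Δ hΔ => ?_, ?_⟩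
  · obtain ⟨h1, h2⟩ := Finset.mem_filter.mp hΔ
    exact ⟨h2, hPmem Δ h1⟩
  have hsplit : (P.card : ℝ) = 𝒢.card + ((P.filter fun Δ => ¬ Squarefree Δ).card : ℝ) := by
    exact_mod_cast (Finset.card_filter_add_card_filter_not (s := P) (p := Squarefree)).symm
  have hbad : ((P.filter fun Δ => ¬ Squarefree Δ).card : ℝ) ≤
      19 / 100 * R ^ 2 / M * (1 / 4) + R := by
    calc ((P.filter fun Δ => ¬ Squarefree Δ).card : ℝ)
          ≤ ∑ j ∈ Finset.range J, ((Q j).card : ℝ) := by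
          exact_mod_cast (Finset.card_le_card hcover).trans Finset.card_biUnion_le
      _ ≤ ∑ j ∈ Finset.range J, (19 / 100 * R ^ 2 / M * (1 / (2 * (j : ℝ) + 3) ^ 2) + 1) :=
          Finset.sum_le_sum hQ
      _ = 19 / 100 * R ^ 2 / M * ∑ j ∈ Finset.range J, 1 / (2 * (j : ℝ) + 3) ^ 2 + J := by
          rw [Finset.sum_add_distrib, ← Finset.mul_sum]; simp
      _ ≤ _ := by
          gcongr
          · exact sum_inv_odd_sq_le J
          · exact Nat.floor_le (by linarith)
  have : 57 / 400 * R ^ 2 / M = 19 / 100 * R ^ 2 / M - 19 / 100 * R ^ 2 / M * (1 / 4) := by ring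
  linarith

lemma mul_sqrt_mul_rpow_quarter_mul_self {R : ℝ} (hR : 0 ≤ R) :
    R * √R * R ^ (1 / 4 : ℝ) * R ^ (1 / 4 : ℝ) = R ^ 2 := by
  have h : R ^ (1 / 4 : ℝ) * R ^ (1 / 4 : ℝ) = √R := by
    rw [← Real.rpow_add_of_nonneg hR (by norm_num) (by norm_num), Real.sqrt_eq_rpow]
    norm_num
  rw [mul_assoc, h, mul_assoc, Real.mul_self_sqrt hR, pow_two]

lemma three_halves_mul_pi_div_le : 3 / 2 * (Real.pi / (20 * √3)) ≤ 1365 / 10000 := by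
  have h1 := Real.pi_lt_d2
  have h2 : (1.732 : ℝ) ≤ √3 := Real.le_sqrt_of_sq_le (by norm_num)
  rw [← mul_div_assoc, div_le_iff₀ (by positivity)]
  linarith

/-- A progression in which few cubic forms have their discriminant contains a positive proportion
of discriminants of imaginary quadratic fields whose class number is prime to `3`. -/
lemma exists_finset_not_three_dvd_classNum {M : ℕ} [NeZero M] (hM2 : 2 ∣ M) {δ : ℤ}
    (hN : 2 * localCount M (δ : ZMod M) ≤ 3 * M ^ 3)
    (hδ : ∀ Δ : ℤ, Δ ≡ δ [ZMOD M] →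
      Δ % 4 = 1 ∧ ∀ q : ℕ, q.Prime → q ∣ M → ¬ (q : ℤ) ^ 2 ∣ Δ)
    {R : ℝ} (hR : 1 ≤ R) (hRM : (18 * (M : ℝ) ^ 2 + 3) * M / (3 / 1000) ≤ R ^ (1 / 4 : ℝ)) :
    ∃ 𝒢 : Finset ℤ, (∀ Δ ∈ 𝒢, Squarefree Δ ∧ Δ ≡ δ [ZMOD M] ∧ Δ < 0 ∧ -(Δ : ℝ) < R ^ 2 ∧
      ¬ 3 ∣ classNum Δ) ∧ 3 / 1000 / M * R ^ 2 ≤ 𝒢.card := by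
  classical
  have hM : 0 < M := Nat.pos_of_neZero M
  have hM' : (0 : ℝ) < M := by exact_mod_cast hM
  obtain ⟨𝒢, h𝒢, hcard⟩ := exists_squarefree_finset hM hM2 (fun Δ h => (hδ Δ h).2) hR
  have hneg : ∀ Δ ∈ 𝒢, Δ < 0 := by
    intro Δ hΔ
    have := (h𝒢 Δ hΔ).2.2.1
    have h : (Δ : ℝ) < 0 := by nlinarith
    exact_mod_cast h
  refine ⟨𝒢.filter fun Δ => ¬ 3 ∣ classNum Δ, fun Δ hΔ => ?_, ?_⟩
  · obtain ⟨h1, h2⟩ := Finset.mem_filter.mp hΔ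
    obtain ⟨h3, h4, -, h5⟩ := h𝒢 Δ h1
    exact ⟨h3, h4, hneg Δ h1, h5, h2⟩
  have hsum : (𝒢.card : ℝ) = ((𝒢.filter fun Δ => 3 ∣ classNum Δ).card : ℝ) +
      ((𝒢.filter fun Δ => ¬ 3 ∣ classNum Δ).card : ℝ) := by
    exact_mod_cast (Finset.card_filter_add_card_filter_not (s := 𝒢)
      (p := fun Δ => 3 ∣ classNum Δ)).symm
  have hB := mul_card_le_localCount_mul (M := M) (δ := δ) hR
    (ℬ := 𝒢.filter fun Δ => 3 ∣ classNum Δ) (fun Δ hΔ => by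
      obtain ⟨h1, h2⟩ := Finset.mem_filter.mp hΔ
      obtain ⟨h3, h4, h5, h6⟩ := h𝒢 Δ h1
      exact ⟨hneg Δ h1, (hδ Δ h4).1, h3, h2, h4, h5, h6.le⟩)
  set B : ℝ := ((𝒢.filter fun Δ => 3 ∣ classNum Δ).card : ℝ)
  set q : ℝ := R ^ (1 / 4 : ℝ)
  have hq1 : 1 ≤ q := Real.one_le_rpow hR (by norm_num)
  have hs1 : 1 ≤ √R := Real.one_le_sqrt.mpr hR
  set E : ℝ := R * √R * q with hE
  have hRE : R ≤ E := by
    rw [hE, mul_assoc]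
    exact le_mul_of_one_le_right (by linarith) (one_le_mul_of_one_le_of_one_le hs1 hq1)
  have hEq : E * q = R ^ 2 := mul_sqrt_mul_rpow_quarter_mul_self (by linarith)
  have hN' : (localCount M (δ : ZMod M) : ℝ) ≤ 3 / 2 * M ^ 3 := by
    have : (2 * localCount M (δ : ZMod M) : ℝ) ≤ 3 * M ^ 3 := by exact_mod_cast hN
    linarith
  have hB2 : B ≤ 1365 / 10000 * R ^ 2 / M + 18 * M ^ 2 * E := by
    have h1 : (M : ℝ) * B ≤ 3 / 2 * M ^ 3 *
        (Real.pi / (20 * √3) * R ^ 2 / M ^ 3 + 12 * E) :=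
      hB.trans (by gcongr)
    have h2 : 3 / 2 * (M : ℝ) ^ 3 * (Real.pi / (20 * √3) * R ^ 2 / M ^ 3 + 12 * E) =
        3 / 2 * (Real.pi / (20 * √3)) * R ^ 2 + 18 * M ^ 3 * E := by
      field_simp
      ring
    have h3 : 3 / 2 * (Real.pi / (20 * √3)) * R ^ 2 ≤ 1365 / 10000 * R ^ 2 := by
      gcongr
      exact three_halves_mul_pi_div_le
    refine le_of_mul_le_mul_left ?_ hM'
    calc (M : ℝ) * B ≤ 1365 / 10000 * R ^ 2 + 18 * M ^ 3 * E := by linarith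
      _ = M * (1365 / 10000 * R ^ 2 / M + 18 * M ^ 2 * E) := by field_simp
  have herr : (18 * (M : ℝ) ^ 2 + 3) * E ≤ 3 / 1000 * R ^ 2 / M := by
    rw [div_le_iff₀ (by norm_num)] at hRM
    rw [le_div_iff₀ hM', ← hEq]
    nlinarith
  have h1 : 57 / 400 * R ^ 2 / (M : ℝ) = 1365 / 10000 * R ^ 2 / M + 2 * (3 / 1000 * R ^ 2 / M) := by
    field_simp
    norm_num
  have h2 : 3 / 1000 / (M : ℝ) * R ^ 2 = 3 / 1000 * R ^ 2 / M := by ring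
  linarith

/-- for any finite set `S` of odd primes and any prescription `σ` of splitting
types, a positive proportion of negative fundamental discriminants `Δ` satisfy `3 ∤ h(Δ)` and
realize the prescribed splitting type at every `p ∈ S`. -/
theorem positive_proportion_prescribed_splitting
    (S : Finset ℕ) (hS : ∀ p ∈ S, p.Prime ∧ p ≠ 2) (σ : ℕ → SplittingType) :
    ∃ c : ℝ, 0 < c ∧ ∃ x₀ : ℝ, 0 < x₀ ∧ ∀ x : ℝ, x₀ ≤ x →
      c * x ≤ ((Nat.card {Δ : ℤ | IsFundamentalDiscriminant Δ ∧ Δ < 0 ∧ |(Δ : ℝ)| < x ∧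
        ¬ (3 ∣ classNum Δ) ∧ ∀ p ∈ S, HasSplittingType p Δ (σ p)} : ℕ) : ℝ) := by
  obtain ⟨M, _, δ, hN, hM2, hδ⟩ := exists_residue_class σ S hS
  have hM' : (0 : ℝ) < M := by exact_mod_cast Nat.pos_of_neZero M
  set K : ℝ := (18 * (M : ℝ) ^ 2 + 3) * M / (3 / 1000)
  have hK0 : 0 ≤ K := by positivity
  refine ⟨3 / 1000 / M, by positivity, max 1 (K ^ 8), by positivity, fun x hx => ?_⟩
  have hx1 : 1 ≤ x := (le_max_left _ _).trans hx
  have hR1 : 1 ≤ √x := Real.one_le_sqrt.mpr hx1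
  have hRx : √x ^ 2 = x := Real.sq_sqrt (by linarith)
  have hKR : K ≤ √x ^ (1 / 4 : ℝ) := by
    have h1 : K ^ 4 ≤ √x :=
      Real.le_sqrt_of_sq_le (by rw [← pow_mul]; exact (le_max_right _ _).trans hx)
    calc K = (K ^ 4) ^ (1 / 4 : ℝ) := by
          rw [← Real.rpow_natCast, ← Real.rpow_mul hK0]
          norm_num
      _ ≤ √x ^ (1 / 4 : ℝ) := by gcongr
  obtain ⟨𝒢, h𝒢, hcard⟩ := exists_finset_not_three_dvd_classNum hM2 hN
    (fun Δ h => ⟨(hδ Δ h).1, (hδ Δ h).2.2⟩) hR1 hKR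
  rw [hRx] at hcard h𝒢
  refine hcard.trans ?_
  rw [Nat.cast_le, ← Set.ncard_coe_finset, Nat.card_coe_set_eq]
  refine Set.ncard_le_ncard (fun Δ hΔ => ?_) ?_
  · obtain ⟨h1, h2, h3, h4, h5⟩ := h𝒢 Δ hΔ
    obtain ⟨h6, h7, -⟩ := hδ Δ h2
    refine ⟨⟨by omega, Or.inl ⟨h6, h1⟩⟩, h3, ?_, h5, h7⟩
    rw [abs_of_neg (by exact_mod_cast h3)]
    exact h4
  · refine (Set.finite_Icc (-⌈x⌉) ⌈x⌉).subset fun Δ hΔ => ?_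
    have h := abs_lt.mp hΔ.2.2.1
    have h1 := Int.le_ceil x
    have h2 : (-⌈x⌉ : ℝ) ≤ Δ := by linarith
    have h3 : (Δ : ℝ) ≤ ⌈x⌉ := by linarith
    exact ⟨by exact_mod_cast h2, by exact_mod_cast h3⟩
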